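/- Let τ > √6, let 0 < β < 1/6, and let ρ_min be a minimizing measure with support M. Let γ : (−δ, δ) → S² be a smooth curve parametrized by arc length with γ(0) = p = (1,0,0) and γ'(0) = (0,1,0), and assume that p is a uniform two-sided accumulation point on γ of scaling β. Set q₁ = (cos θ_max, 0, sin θ_max). If q₁ is an accumulation point of M, then there exist δ' > 0 and a real analytic curve c : (−δ', δ') → S² parametrized by arc length with c(0) = q₁ which osculates K(p) at q₁, such that q₁ is an accumulation point of M ∩ c((−δ', δ')). -/

import Mathlib

open MeasureTheory Set
open scoped RealInnerProductSpace ENNReal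

noncomputable section

/-- Euclidean three-space. -/
abbrev E3 := EuclideanSpace ℝ (Fin 3)

/-- The unit sphere `S² ⊂ ℝ³`. -/
def Sphere2 : Set E3 := Metric.sphere 0 1

/-- The function `D(x,y) = (1/4)(1+⟨x,y⟩)(2 − τ²(1−⟨x,y⟩))`. -/
def Dfun (τ : ℝ) (x y : E3) : ℝ :=
  (1 / 4) * (1 + ⟪x, y⟫) * (2 - τ ^ 2 * (1 - ⟪x, y⟫))

/-- The Lagrangian `L = max(0, D)`. -/
def Lfun (τ : ℝ) (x y : E3) : ℝ := max 0 (Dfun τ x y)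

/-- The causal action of a measure. -/
def causalAction (τ : ℝ) (ρ : Measure E3) : ℝ :=
  ∫ x, ∫ y, Lfun τ x y ∂ρ ∂ρ

/-- `ρ` is a minimizing measure: a regular Borel probability measure supported on `S²`
minimizing the causal action among all such measures. -/
def IsMinimizer (τ : ℝ) (ρ : Measure E3) : Prop :=
  IsProbabilityMeasure ρ ∧ ρ.Regular ∧ ρ Sphere2ᶜ = 0 ∧
    ∀ ρ' : Measure E3, IsProbabilityMeasure ρ' → ρ'.Regular → ρ' Sphere2ᶜ = 0 →
      causalAction τ ρ ≤ causalAction τ ρ'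

/-- The support of a measure. -/
def msupport (ρ : Measure E3) : Set E3 :=
  {x | ∀ U : Set E3, IsOpen U → x ∈ U → 0 < ρ U}

/-- The opening angle `θ_max = arccos(1 − 2/τ²)`. -/
def θmax (τ : ℝ) : ℝ := Real.arccos (1 - 2 / τ ^ 2)

/-- The open light cone `I(p)`. -/
def lightConeI (τ : ℝ) (p : E3) : Set E3 := {q ∈ Sphere2 | 0 < Dfun τ p q}

/-- The boundary of the light cone `K(p)`. -/
def lightConeK (τ : ℝ) (p : E3) : Set E3 :=
  {q ∈ Sphere2 | ⟪p, q⟫ = Real.cos (θmax τ)}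

/-- Make a point of `ℝ³` from coordinates. -/
def mkE3 (a b c : ℝ) : E3 := (WithLp.equiv 2 (Fin 3 → ℝ)).symm ![a, b, c]

/-- A totally timelike set. -/
def TotallyTimelike (τ : ℝ) (Ω : Set E3) : Prop := ∀ x ∈ Ω, ∀ y ∈ Ω, 0 < Dfun τ x y

/-- `p` is an accumulation point of `A`: every neighborhood of `p` contains a point
of `A` different from `p`. -/
def AccumulationPt (p : E3) (A : Set E3) : Prop :=
  ∀ U ∈ nhds p, ∃ x ∈ A, x ∈ U ∧ x ≠ p

/-- `γ(0)` is a uniform two-sided accumulation point (of points of `M`) on `γ` of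
scaling `β`, where `γ` is defined on `(−δ, δ)`. -/
def UniformTwoSidedAcc (M : Set E3) (β δ : ℝ) (γ : ℝ → E3) : Prop :=
  ∃ ε₀ : ℝ, 0 < ε₀ ∧ ε₀ < δ ∧ ∀ ε : ℝ, 0 < ε → ε ≤ ε₀ →
    (∃ t ∈ Set.Ioo (-ε) (-(ε ^ (1 + β))), γ t ∈ M) ∧
    (∃ t ∈ Set.Ioo (ε ^ (1 + β)) ε, γ t ∈ M)

/-- The point `q₁ = (cos θ_max, 0, sin θ_max)`. -/
def q1pt (τ : ℝ) : E3 := mkE3 (Real.cos (θmax τ)) 0 (Real.sin (θmax τ))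

/-- The point `q₂ = (cos θ_max, 0, −sin θ_max)`. -/
def q2pt (τ : ℝ) : E3 := mkE3 (Real.cos (θmax τ)) 0 (-Real.sin (θmax τ))

/-- The curve `p_s = (cos s, sin s, 0)` along the equator. -/
def pcurve (s : ℝ) : E3 := mkE3 (Real.cos s) (Real.sin s) 0

/-- Geodesic ball in `S²` of radius `r` around `q`. -/
def geoBall (q : E3) (r : ℝ) : Set E3 := {x ∈ Sphere2 | Real.arccos ⟪q, x⟫ < r}

/-- The set `U_r = (B_r(q₁) ∪ B_r(q₂)) ∖ {q₁, q₂}`. -/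
def Uset (τ r : ℝ) : Set E3 := (geoBall (q1pt τ) r ∪ geoBall (q2pt τ) r) \ {q1pt τ, q2pt τ}

/-- The set `I_r(q) = I(q) ∖ U_r`. -/
def Iset (τ r : ℝ) (q : E3) : Set E3 := lightConeI τ q \ Uset τ r

/-- The point of `S²` with latitude `θ` (measured from the equator) and longitude `φ`. -/
def sphPt (θ φ : ℝ) : E3 :=
  mkE3 (Real.cos θ * Real.cos φ) (Real.cos θ * Real.sin φ) (Real.sin θ)

/-- The restrictions to `Ω` of polynomials of degree at most two on `ℝ³`. -/
def polyRestrictSet (Ω : Set E3) : Set (Ω → ℝ) :=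
  {f | ∃ P : MvPolynomial (Fin 3) ℝ, P.totalDegree ≤ 2 ∧
        ∀ x : Ω, f x = MvPolynomial.eval (fun i => (x : E3) i) P}

/-- The space `K(Ω)` of restrictions to `Ω` of polynomials of degree at most two. -/
def KSpace (Ω : Set E3) : Submodule ℝ (Ω → ℝ) := Submodule.span ℝ (polyRestrictSet Ω)

/-- Two-dimensional Hausdorff (surface) measure on `S²` restricted to `Ω`, as a
measure on `Ω`. -/
def surfΩ (Ω : Set E3) : Measure Ω := Measure.comap Subtype.val (μH[2] : Measure E3)

/-- The bilinear form `B(f,g) = ∫_Ω ∫_Ω D(x,y) f(x) g(y) dμ(x) dμ(y)` on functions on `Ω`. -/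
def Bform (τ : ℝ) (Ω : Set E3) (f g : Ω → ℝ) : ℝ :=
  ∫ x, ∫ y, Dfun τ (x : E3) (y : E3) * f x * g y ∂(surfΩ Ω) ∂(surfΩ Ω)

end

lemma aux_Dcont (τ : ℝ) : Continuous (fun z : E3 × E3 => Dfun τ z.1 z.2) := by
  unfold Dfun; fun_prop

lemma aux_Lcont (τ : ℝ) : Continuous (fun z : E3 × E3 => Lfun τ z.1 z.2) := by
  unfold Lfun; exact continuous_const.max (aux_Dcont τ)

lemma aux_Lnonneg (τ : ℝ) (x y : E3) : 0 ≤ Lfun τ x y := le_max_left _ _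

lemma aux_Lsymm (τ : ℝ) (x y : E3) : Lfun τ x y = Lfun τ y x := by
  unfold Lfun Dfun; rw [real_inner_comm]

lemma aux_comp : IsCompact Sphere2 := isCompact_sphere _ _

lemma aux_ae (ρ : Measure E3) (h : ρ Sphere2ᶜ = 0) : ∀ᵐ x ∂ρ, x ∈ Sphere2 := by
  rw [ae_iff]; exact h

lemma aux_restrict (ρ : Measure E3) (h : ρ Sphere2ᶜ = 0) : ρ.restrict Sphere2 = ρ :=
  Measure.restrict_eq_self_of_ae_mem (aux_ae ρ h)

lemma aux_int (ρ : Measure E3) [IsProbabilityMeasure ρ] (h : ρ Sphere2ᶜ = 0) (f : E3 → ℝ)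
    (hf : Continuous f) : Integrable f ρ := by
  have := hf.continuousOn.integrableOn_compact (μ := ρ) aux_comp
  rwa [IntegrableOn, aux_restrict ρ h] at this

lemma aux_Lbdd (τ : ℝ) : ∃ C : ℝ, 0 ≤ C ∧ ∀ x ∈ Sphere2, ∀ y ∈ Sphere2, |Lfun τ x y| ≤ C := by
  obtain ⟨C, hC⟩ := (aux_comp.prod aux_comp).exists_bound_of_continuousOn
    (aux_Lcont τ).continuousOn
  refine ⟨max C 0, le_max_right _ _, fun x hx y hy => ?_⟩
  exact (hC (x, y) ⟨hx, hy⟩).trans (le_max_left _ _)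

lemma aux_aeprod (ρ : Measure E3) [IsProbabilityMeasure ρ] (h : ρ Sphere2ᶜ = 0) :
    ∀ᵐ z ∂(ρ.prod ρ), z.1 ∈ Sphere2 ∧ z.2 ∈ Sphere2 := by
  have h1 : ∀ᵐ z ∂(ρ.prod ρ), z.1 ∈ Sphere2 :=
    Measure.quasiMeasurePreserving_fst.ae (aux_ae ρ h)
  have h2 : ∀ᵐ z ∂(ρ.prod ρ), z.2 ∈ Sphere2 :=
    Measure.quasiMeasurePreserving_snd.ae (aux_ae ρ h)
  filter_upwards [h1, h2] with z a b using ⟨a, b⟩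

lemma aux_intprod (τ : ℝ) (ρ : Measure E3) [IsProbabilityMeasure ρ] (h : ρ Sphere2ᶜ = 0)
    (f g : E3 → ℝ) (hf : Measurable f) (hg : Measurable g) (A B : ℝ) (hA : ∀ x, |f x| ≤ A)
    (hB : ∀ x, |g x| ≤ B) :
    Integrable (fun z : E3 × E3 => f z.1 * g z.2 * Lfun τ z.1 z.2) (ρ.prod ρ) := by
  obtain ⟨C, hC0, hC⟩ := aux_Lbdd τ
  refine Integrable.mono' (integrable_const (A * B * C)) ?_ ?_
  · have := (aux_Lcont τ).measurable
    exact (((hf.comp measurable_fst).mul (hg.comp measurable_snd)).mul this).aestronglyMeasurable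
  · filter_upwards [aux_aeprod ρ h] with z hz
    rw [Real.norm_eq_abs, abs_mul, abs_mul]
    have := hA z.1
    have := hB z.2
    have := hC z.1 hz.1 z.2 hz.2
    have := (abs_nonneg _).trans (hA z.1)
    have := (abs_nonneg _).trans (hB z.2)
    gcongr

lemma aux_action (τ : ℝ) (ρ : Measure E3) [IsProbabilityMeasure ρ] (h : ρ Sphere2ᶜ = 0) :
    causalAction τ ρ = ∫ z, Lfun τ z.1 z.2 ∂(ρ.prod ρ) := by
  have := aux_intprod τ ρ h (fun _ => 1) (fun _ => 1) measurable_const measurable_const 1 1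
    (by simp) (by simp)
  simp only [one_mul] at this
  rw [integral_prod _ this]; rfl

lemma aux_W (τ : ℝ) (ρ : Measure E3) (hmin : IsMinimizer τ ρ) (w : E3 → ℝ) (hw : Measurable w)
    (C : ℝ) (h0 : ∀ x, 0 ≤ w x) (hC : ∀ x, w x ≤ C) :
    causalAction τ ρ * (∫ x, w x ∂ρ) ^ 2 ≤ ∫ z, w z.1 * w z.2 * Lfun τ z.1 z.2 ∂(ρ.prod ρ) := by
  obtain ⟨hp, hr, hS, hm⟩ := hmin
  have habs : ∀ x, |w x| ≤ C := fun x => by rw [abs_of_nonneg (h0 x)]; exact hC x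
  have hwi : Integrable w ρ := Integrable.mono' (integrable_const C) hw.aestronglyMeasurable
    (Filter.Eventually.of_forall habs)
  rcases (integral_nonneg (μ := ρ) (f := w) h0).eq_or_lt with hW | hW
  · have hW' : (∫ x, w x ∂ρ) = 0 := hW.symm
    rw [hW']; simp only [ne_eq, OfNat.ofNat_ne_zero, not_false_eq_true, zero_pow, mul_zero]
    exact integral_nonneg fun z => mul_nonneg (mul_nonneg (h0 _) (h0 _)) (aux_Lnonneg _ _ _)
  set W := ∫ x, w x ∂ρ with hWdef
  set d : E3 → ℝ≥0∞ := fun x => ENNReal.ofReal (w x / W) with hd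
  have hdm : Measurable d := by fun_prop
  have hdt : ∀ᵐ x ∂ρ, d x < ⊤ := Filter.Eventually.of_forall fun x => ENNReal.ofReal_lt_top
  have hdr : ∀ x, (d x).toReal = w x / W := fun x => by
    rw [hd]; exact ENNReal.toReal_ofReal (div_nonneg (h0 x) hW.le)
  set ρ' := ρ.withDensity d with hρ'
  have hp' : IsProbabilityMeasure ρ' := by
    constructor
    rw [hρ', withDensity_apply _ MeasurableSet.univ, Measure.restrict_univ,
      ← ofReal_integral_eq_lintegral_ofReal (hwi.div_const W)
        (Filter.Eventually.of_forall fun x => div_nonneg (h0 x) hW.le), integral_div,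
      ← hWdef, div_self hW.ne']
    simp
  have hS' : ρ' Sphere2ᶜ = 0 := withDensity_absolutelyContinuous ρ d hS
  have key := hm ρ' hp' inferInstance hS'
  have hact : causalAction τ ρ' =
      (∫ z, w z.1 * w z.2 * Lfun τ z.1 z.2 ∂(ρ.prod ρ)) / W ^ 2 := by
    rw [integral_prod _ (aux_intprod τ ρ hS w w hw hw C C habs habs)]
    unfold causalAction
    rw [hρ', integral_withDensity_eq_integral_toReal_smul hdm hdt, ← integral_div]
    refine integral_congr_ae (Filter.Eventually.of_forall fun x => ?_)
    simp only
    rw [integral_withDensity_eq_integral_toReal_smul hdm hdt, hdr, smul_eq_mul,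
      ← integral_const_mul, ← integral_div]
    refine integral_congr_ae (Filter.Eventually.of_forall fun y => ?_)
    simp only [hdr, smul_eq_mul]
    field_simp
  rw [hact, le_div_iff₀ (by positivity)] at key
  exact key

lemma aux_S_nonneg (τ : ℝ) (ρ : Measure E3) : 0 ≤ causalAction τ ρ :=
  integral_nonneg fun x => integral_nonneg fun y => aux_Lnonneg _ _ _

lemma aux_B (τ : ℝ) (ρ : Measure E3) (hmin : IsMinimizer τ ρ) (f : E3 → ℝ) (hf : Measurable f)
    (C : ℝ) (hC : ∀ x, |f x| ≤ C) :
    0 ≤ ∫ z, f z.1 * f z.2 * Lfun τ z.1 z.2 ∂(ρ.prod ρ) := by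
  have hp := hmin.1
  have hS := hmin.2.2.1
  have hC0 : 0 ≤ C := (abs_nonneg _).trans (hC 0)
  set s : ℝ := 1 / (C + 1) with hs
  have hspos : 0 < s := by positivity
  have hsf : ∀ x, |s * f x| ≤ 1 := fun x => by
    rw [abs_mul, abs_of_pos hspos, hs]
    rw [one_div, inv_mul_le_iff₀ (by positivity)]
    linarith [hC x]
  have hfi : Integrable f ρ := Integrable.mono' (integrable_const C) hf.aestronglyMeasurable
    (Filter.Eventually.of_forall hC)
  have e1 := aux_W τ ρ hmin (fun x => 1 + s * f x) (by fun_prop) 2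
    (fun x => by linarith [(abs_le.1 (hsf x)).1]) (fun x => by linarith [(abs_le.1 (hsf x)).2])
  have e2 := aux_W τ ρ hmin (fun x => 1 - s * f x) (by fun_prop) 2
    (fun x => by linarith [(abs_le.1 (hsf x)).2]) (fun x => by linarith [(abs_le.1 (hsf x)).1])
  have i11 := aux_intprod τ ρ hS (fun _ => 1) (fun _ => 1) measurable_const measurable_const 1 1
    (by simp) (by simp)
  have iff := aux_intprod τ ρ hS f f hf hf C C hC hC
  have ip := aux_intprod τ ρ hS (fun x => 1 + s * f x) (fun x => 1 + s * f x) (by fun_prop)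
    (by fun_prop) 2 2 (fun x => by rw [abs_le]; constructor <;> linarith [(abs_le.1 (hsf x)).1, (abs_le.1 (hsf x)).2])
    (fun x => by rw [abs_le]; constructor <;> linarith [(abs_le.1 (hsf x)).1, (abs_le.1 (hsf x)).2])
  have im := aux_intprod τ ρ hS (fun x => 1 - s * f x) (fun x => 1 - s * f x) (by fun_prop)
    (by fun_prop) 2 2 (fun x => by rw [abs_le]; constructor <;> linarith [(abs_le.1 (hsf x)).1, (abs_le.1 (hsf x)).2])
    (fun x => by rw [abs_le]; constructor <;> linarith [(abs_le.1 (hsf x)).1, (abs_le.1 (hsf x)).2])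
  have hsum := add_le_add e1 e2
  rw [← integral_add ip im] at hsum
  have hexp : ∫ z : E3 × E3, ((1 + s * f z.1) * (1 + s * f z.2) * Lfun τ z.1 z.2 +
      (1 - s * f z.1) * (1 - s * f z.2) * Lfun τ z.1 z.2) ∂(ρ.prod ρ) =
      2 * causalAction τ ρ + 2 * s ^ 2 *
        ∫ z, f z.1 * f z.2 * Lfun τ z.1 z.2 ∂(ρ.prod ρ) := by
    rw [aux_action τ ρ hS, ← integral_const_mul, ← integral_const_mul, ← integral_add]
    · congr 1; ext z; ring
    · have := i11.const_mul 2
      simpa using this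
    · exact iff.const_mul _
  rw [hexp] at hsum
  have w1 : ∫ x, (1 + s * f x) ∂ρ = 1 + s * ∫ x, f x ∂ρ := by
    rw [integral_add (integrable_const _) (hfi.const_mul s), integral_const_mul]; simp
  have w2 : ∫ x, (1 - s * f x) ∂ρ = 1 - s * ∫ x, f x ∂ρ := by
    rw [integral_sub (integrable_const _) (hfi.const_mul s), integral_const_mul]; simp
  rw [w1, w2] at hsum
  have hA := aux_S_nonneg τ ρ
  have : 0 ≤ causalAction τ ρ * (s * ∫ x, f x ∂ρ) ^ 2 := by positivity
  have h3 : 0 ≤ s ^ 2 * ∫ z, f z.1 * f z.2 * Lfun τ z.1 z.2 ∂(ρ.prod ρ) := by nlinarith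
  exact nonneg_of_mul_nonneg_right h3 (by positivity)

lemma aux_psd (τ : ℝ) (ρ : Measure E3) (hmin : IsMinimizer τ ρ) {n : ℕ} (x : Fin n → E3)
    (hx : ∀ i, x i ∈ msupport ρ) (a : Fin n → ℝ) :
    0 ≤ ∑ i, ∑ j, a i * a j * Lfun τ (x i) (x j) := by
  have hp := hmin.1
  have hS := hmin.2.2.1
  refine le_of_forall_pos_le_add fun e he => ?_
  set T : ℝ := (∑ i, ∑ j, |a i * a j|) + 1 with hT
  have hTpos : 0 < T := by positivity
  set e' := e / T with he'
  have he'pos : 0 < e' := by positivity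
  have hr : ∃ r > 0, ∀ i j, ∀ y ∈ Metric.ball (x i) r, ∀ z ∈ Metric.ball (x j) r,
      |Lfun τ y z - Lfun τ (x i) (x j)| ≤ e' := by
    have : ∀ i j, ∀ᶠ r in nhdsWithin (0:ℝ) (Ioi 0), ∀ y ∈ Metric.ball (x i) r,
        ∀ z ∈ Metric.ball (x j) r, |Lfun τ y z - Lfun τ (x i) (x j)| ≤ e' := by
      intro i j
      have := (aux_Lcont τ).continuousAt (x := (x i, x j))
      rw [Metric.continuousAt_iff] at this
      obtain ⟨r, hr, h⟩ := this e' he'pos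
      filter_upwards [Ioo_mem_nhdsGT hr] with r' hr' y hy z hz
      have := @h (y, z) (by
        rw [Prod.dist_eq]; exact max_lt (lt_trans hy hr'.2) (lt_trans hz hr'.2))
      exact le_of_lt this
    have h2 := Filter.eventually_all.2 fun i => Filter.eventually_all.2 fun j => this i j
    obtain ⟨r, hr1, hr2⟩ := (h2.and self_mem_nhdsWithin).exists
    exact ⟨r, hr2, hr1⟩
  obtain ⟨r, hr0, hr⟩ := hr
  have hm : ∀ i, 0 < ρ.real (Metric.ball (x i) r) := fun i =>
    ENNReal.toReal_pos (hx i _ Metric.isOpen_ball (Metric.mem_ball_self hr0)).ne'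
      (measure_ne_top _ _)
  set φ : Fin n → E3 → ℝ := fun i => (Metric.ball (x i) r).indicator
    (fun _ => (ρ.real (Metric.ball (x i) r))⁻¹) with hφ
  have hφm : ∀ i, Measurable (φ i) := fun i =>
    measurable_const.indicator Metric.isOpen_ball.measurableSet
  have hφ0 : ∀ i y, 0 ≤ φ i y := fun i y => indicator_nonneg (fun _ _ => (inv_pos.2 (hm i)).le) y
  have hφb : ∀ i y, |φ i y| ≤ (ρ.real (Metric.ball (x i) r))⁻¹ := fun i y => by
    rw [abs_of_nonneg (hφ0 i y)]
    exact indicator_le_self' (fun _ _ => (inv_pos.2 (hm i)).le) y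
  have hφi : ∀ i, ∫ y, φ i y ∂ρ = 1 := fun i => by
    rw [hφ, integral_indicator Metric.isOpen_ball.measurableSet]
    simp only [integral_const, MeasurableSet.univ, measureReal_restrict_apply, univ_inter, smul_eq_mul]
    exact mul_inv_cancel₀ (hm i).ne'
  have hII := fun i j => aux_intprod τ ρ hS (φ i) (φ j) (hφm i) (hφm j) _ _ (hφb i) (hφb j)
  have hIJ : ∀ i j, |∫ z, φ i z.1 * φ j z.2 * Lfun τ z.1 z.2 ∂(ρ.prod ρ)
      - Lfun τ (x i) (x j)| ≤ e' := by
    intro i j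
    have hint : Integrable (fun z : E3 × E3 => φ i z.1 * φ j z.2) (ρ.prod ρ) := by
      apply Integrable.mul_prod
      · exact Integrable.mono' (integrable_const _) (hφm i).aestronglyMeasurable
          (Filter.Eventually.of_forall (hφb i))
      · exact Integrable.mono' (integrable_const _) (hφm j).aestronglyMeasurable
          (Filter.Eventually.of_forall (hφb j))
    have h1 : ∫ z : E3 × E3, φ i z.1 * φ j z.2 ∂(ρ.prod ρ) = 1 := by
      rw [integral_prod_mul, hφi, hφi, one_mul]
    have h2 : Lfun τ (x i) (x j) = ∫ z : E3 × E3, φ i z.1 * φ j z.2 * Lfun τ (x i) (x j)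
        ∂(ρ.prod ρ) := by rw [integral_mul_const, h1, one_mul]
    have h3 : e' = ∫ z : E3 × E3, φ i z.1 * φ j z.2 * e' ∂(ρ.prod ρ) := by
      rw [integral_mul_const, h1, one_mul]
    conv_lhs => rw [h2]
    rw [← integral_sub (hII i j) (hint.mul_const _), ← Real.norm_eq_abs]
    conv_rhs => rw [h3]
    refine norm_integral_le_of_norm_le (hint.mul_const _) (Filter.Eventually.of_forall fun z => ?_)
    rw [← mul_sub, Real.norm_eq_abs, abs_mul, abs_of_nonneg (mul_nonneg (hφ0 _ _) (hφ0 _ _))]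
    by_cases hz1 : z.1 ∈ Metric.ball (x i) r
    · by_cases hz2 : z.2 ∈ Metric.ball (x j) r
      · exact mul_le_mul_of_nonneg_left (hr i j _ hz1 _ hz2) (mul_nonneg (hφ0 _ _) (hφ0 _ _))
      · have : φ j z.2 = 0 := indicator_of_notMem hz2 _
        simp [this]
    · have : φ i z.1 = 0 := indicator_of_notMem hz1 _
      simp [this]
  have hB := aux_B τ ρ hmin (fun y => ∑ i, a i * φ i y)
    (Finset.measurable_sum _ fun i _ => (hφm i).const_mul _)
    (∑ i, |a i| * (ρ.real (Metric.ball (x i) r))⁻¹) (fun y => by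
      refine (Finset.abs_sum_le_sum_abs _ _).trans (Finset.sum_le_sum fun i _ => ?_)
      rw [abs_mul]; exact mul_le_mul_of_nonneg_left (hφb i y) (abs_nonneg _))
  have hexp : ∫ z : E3 × E3, (∑ i, a i * φ i z.1) * (∑ i, a i * φ i z.2) * Lfun τ z.1 z.2
      ∂(ρ.prod ρ) = ∑ i, ∑ j, a i * a j *
        ∫ z : E3 × E3, φ i z.1 * φ j z.2 * Lfun τ z.1 z.2 ∂(ρ.prod ρ) := by
    have : ∀ z : E3 × E3, (∑ i, a i * φ i z.1) * (∑ i, a i * φ i z.2) * Lfun τ z.1 z.2 =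
        ∑ i, ∑ j, a i * a j * (φ i z.1 * φ j z.2 * Lfun τ z.1 z.2) := by
      intro z
      rw [Finset.sum_mul_sum, Finset.sum_mul]
      refine Finset.sum_congr rfl fun i _ => ?_
      rw [Finset.sum_mul]
      refine Finset.sum_congr rfl fun j _ => ?_
      ring
    rw [integral_congr_ae (Filter.Eventually.of_forall this)]
    rw [integral_finsetSum _ fun i _ => integrable_finsetSum _ fun j _ => (hII i j).const_mul _]
    refine Finset.sum_congr rfl fun i _ => ?_
    rw [integral_finsetSum _ fun j _ => (hII i j).const_mul _]
    exact Finset.sum_congr rfl fun j _ => integral_const_mul _ _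
  rw [hexp] at hB
  refine hB.trans ?_
  have : ∑ i, ∑ j, a i * a j * ∫ z : E3 × E3, φ i z.1 * φ j z.2 * Lfun τ z.1 z.2 ∂(ρ.prod ρ)
      ≤ ∑ i, ∑ j, (a i * a j * Lfun τ (x i) (x j) + |a i * a j| * e') := by
    refine Finset.sum_le_sum fun i _ => Finset.sum_le_sum fun j _ => ?_
    have h1 : a i * a j * (∫ z : E3 × E3, φ i z.1 * φ j z.2 * Lfun τ z.1 z.2 ∂(ρ.prod ρ)
        - Lfun τ (x i) (x j)) ≤ |a i * a j| * e' := by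
      refine (le_abs_self _).trans ?_
      rw [abs_mul]
      exact mul_le_mul_of_nonneg_left (hIJ i j) (abs_nonneg _)
    linarith
  refine this.trans ?_
  simp_rw [Finset.sum_add_distrib, ← Finset.sum_mul]
  have : (∑ i, ∑ j, |a i * a j|) * e' ≤ T * e' :=
    mul_le_mul_of_nonneg_right (by rw [hT]; linarith) he'pos.le
  have h5 : T * e' = e := by rw [he']; field_simp
  linarith

lemma aux_ell_cont (τ : ℝ) (ρ : Measure E3) [IsProbabilityMeasure ρ] (hS : ρ Sphere2ᶜ = 0) :
    Continuous (fun x => ∫ y, Lfun τ x y ∂ρ) := by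
  have := continuous_parametric_integral_of_continuous (μ := ρ) (f := fun x y => Lfun τ x y)
    (aux_Lcont τ) aux_comp
  rwa [aux_restrict ρ hS] at this

lemma aux_Lcont_right (τ : ℝ) (x : E3) : Continuous (fun y => Lfun τ x y) :=
  (aux_Lcont τ).comp (by fun_prop : Continuous fun y : E3 => (x, y))

lemma aux_Dcont_right (τ : ℝ) (x : E3) : Continuous (fun y => Dfun τ x y) :=
  (aux_Dcont τ).comp (by fun_prop : Continuous fun y : E3 => (x, y))

lemma aux_EL1 (τ : ℝ) (ρ : Measure E3) (hmin : IsMinimizer τ ρ) (x : E3) (hx : x ∈ Sphere2) :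
    causalAction τ ρ ≤ ∫ y, Lfun τ x y ∂ρ := by
  obtain ⟨hp, hr, hS, hm⟩ := hmin
  set l := ∫ y, Lfun τ x y ∂ρ with hl
  have key : ∀ s : ℝ, 0 < s → s < 1 → 0 ≤ 2 * (1 - s) * (l - causalAction τ ρ) +
      s * (Lfun τ x x - causalAction τ ρ) := by
    intro s hs0 hs1
    set ρ' := ENNReal.ofReal (1 - s) • ρ + ENNReal.ofReal s • Measure.dirac x with hρ'
    have hp' : IsProbabilityMeasure ρ' := by
      constructor
      simp only [hρ', Measure.coe_add, Measure.coe_smul, Pi.add_apply, Pi.smul_apply,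
        measure_univ, smul_eq_mul, mul_one]
      rw [← ENNReal.ofReal_add (by linarith) hs0.le]; simp
    have hS' : ρ' Sphere2ᶜ = 0 := by
      simp only [hρ', Measure.coe_add, Measure.coe_smul, Pi.add_apply, Pi.smul_apply, hS,
        smul_eq_mul, mul_zero, zero_add]
      rw [Measure.dirac_apply' _ aux_comp.isClosed.measurableSet.compl]
      simp [hx]
    have h := hm ρ' hp' inferInstance hS'
    have hI : ∀ f : E3 → ℝ, Continuous f → ∫ y, f y ∂ρ' = (1 - s) * ∫ y, f y ∂ρ + s * f x := by
      intro f hf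
      rw [hρ', integral_add_measure, integral_smul_measure, integral_smul_measure, integral_dirac,
        ENNReal.toReal_ofReal hs0.le, ENNReal.toReal_ofReal (by linarith)]
      · rfl
      · exact (aux_int ρ hS f hf).smul_measure ENNReal.ofReal_ne_top
      · exact (aux_int (Measure.dirac x) (by
          rw [Measure.dirac_apply' _ aux_comp.isClosed.measurableSet.compl]; simp [hx])
          f hf).smul_measure ENNReal.ofReal_ne_top
    have hact : causalAction τ ρ' = (1 - s) ^ 2 * causalAction τ ρ + 2 * s * (1 - s) * l
        + s ^ 2 * Lfun τ x x := by
      unfold causalAction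
      rw [hI _ (aux_ell_cont τ ρ' hS')]
      simp_rw [hI _ (aux_Lcont_right τ _)]
      have hc := aux_ell_cont τ ρ hS
      have hc2 : Continuous fun y => Lfun τ y x := by
        simp_rw [aux_Lsymm τ _ x]; exact aux_Lcont_right τ x
      have : ∫ y, Lfun τ y x ∂ρ = l := by simp_rw [aux_Lsymm τ _ x]; rfl
      rw [integral_add ((aux_int ρ hS _ hc).const_mul _) ((aux_int ρ hS _ hc2).const_mul _),
        integral_const_mul, integral_const_mul, this, ← hl]
      ring
    rw [hact] at h
    have : 0 ≤ s * (2 * (1 - s) * (l - causalAction τ ρ) +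
      s * (Lfun τ x x - causalAction τ ρ)) := by nlinarith
    exact nonneg_of_mul_nonneg_right this hs0
  by_contra hlt
  push Not at hlt
  have ht : Filter.Tendsto (fun s : ℝ => 2 * (1 - s) * (l - causalAction τ ρ) +
      s * (Lfun τ x x - causalAction τ ρ)) (nhdsWithin 0 (Ioi 0))
      (nhds (2 * (1 - 0) * (l - causalAction τ ρ) + 0 * (Lfun τ x x - causalAction τ ρ))) :=
    (Continuous.tendsto (by fun_prop) 0).mono_left nhdsWithin_le_nhds
  have := ge_of_tendsto ht (b := 0) (by
    filter_upwards [Ioo_mem_nhdsGT (zero_lt_one (α := ℝ))] with s hs using key s hs.1 hs.2)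
  linarith

lemma aux_EL2 (τ : ℝ) (ρ : Measure E3) (hmin : IsMinimizer τ ρ) (x : E3)
    (hx : x ∈ msupport ρ) : ∫ y, Lfun τ x y ∂ρ ≤ causalAction τ ρ := by
  have hp := hmin.1
  have hS := hmin.2.2.1
  have hc := aux_ell_cont τ ρ hS
  by_contra hlt
  push Not at hlt
  have hi := aux_int ρ hS _ hc
  have h0 : ∫ x, ((∫ y, Lfun τ x y ∂ρ) - causalAction τ ρ) ∂ρ = 0 := by
    rw [integral_sub hi (integrable_const _)]
    simp [causalAction]
  rw [integral_eq_zero_iff_of_nonneg_ae] at h0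
  · have := hx {z | causalAction τ ρ < ∫ y, Lfun τ z y ∂ρ} (isOpen_lt continuous_const hc) hlt
    refine this.ne' (measure_mono_null ?_ h0)
    intro z hz h
    simp only [mem_ofPred_eq, Pi.zero_apply] at hz h
    linarith
  · filter_upwards [aux_ae ρ hS] with z hz
    simpa using aux_EL1 τ ρ hmin z hz
  · exact hi.sub (integrable_const _)

lemma aux_supp_sphere (ρ : Measure E3) (hS : ρ Sphere2ᶜ = 0) {x : E3} (hx : x ∈ msupport ρ) :
    x ∈ Sphere2 := by
  by_contra h
  exact (hx _ aux_comp.isClosed.isOpen_compl h).ne' hS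

lemma aux_ae_supp (ρ : Measure E3) : ∀ᵐ x ∂ρ, x ∈ msupport ρ := by
  rw [ae_iff]
  refine measure_null_of_locally_null _ fun x hx => ?_
  simp only [msupport, mem_ofPred_eq, not_forall] at hx
  obtain ⟨U, hU, hxU, h⟩ := hx
  exact ⟨U, mem_nhdsWithin_of_mem_nhds (hU.mem_nhds hxU), by simpa using h⟩

lemma aux_inner (x y : E3) : ⟪x, y⟫ = x 0 * y 0 + x 1 * y 1 + x 2 * y 2 := by
  simp [PiLp.inner_apply, Fin.sum_univ_three]; ring

lemma aux_sph (x : E3) (hx : x ∈ Sphere2) : ‖x‖ = 1 := by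
  simpa [Sphere2] using hx

lemma aux_sph2 (x : E3) (hx : x ∈ Sphere2) : x 0 ^ 2 + x 1 ^ 2 + x 2 ^ 2 = 1 := by
  have h := real_inner_self_eq_norm_sq x
  rw [aux_inner, aux_sph x hx] at h
  linarith

lemma aux_coord (x : E3) (hx : x ∈ Sphere2) (k : Fin 3) : |x k| ≤ 1 := by
  have := PiLp.norm_apply_le x k
  rwa [aux_sph x hx] at this

lemma aux_inner_le (x y : E3) (hx : x ∈ Sphere2) (hy : y ∈ Sphere2) : |⟪x, y⟫| ≤ 1 := by
  have := abs_real_inner_le_norm x y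
  rwa [aux_sph x hx, aux_sph y hy, one_mul] at this

lemma aux_Dself (τ : ℝ) (x : E3) (hx : x ∈ Sphere2) : Dfun τ x x = 1 := by
  unfold Dfun
  rw [real_inner_self_eq_norm_sq, aux_sph x hx]; norm_num

lemma aux_Dlip (τ : ℝ) (x y q : E3) (hx : x ∈ Sphere2) (hy : y ∈ Sphere2) (hq : q ∈ Sphere2) :
    |Dfun τ x q - Dfun τ y q| ≤ (1 + τ ^ 2) * ‖x - y‖ := by
  have h1 : |⟪x, q⟫ - ⟪y, q⟫| ≤ ‖x - y‖ := by
    rw [← inner_sub_left]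
    have := abs_real_inner_le_norm (x - y) q
    rwa [aux_sph q hq, mul_one] at this
  have h2 := abs_le.1 (aux_inner_le x q hx hq)
  have h3 := abs_le.1 (aux_inner_le y q hy hq)
  have h4 : Dfun τ x q - Dfun τ y q =
      ((1 / 4) * (2 + τ ^ 2 * (⟪x, q⟫ + ⟪y, q⟫))) * (⟪x, q⟫ - ⟪y, q⟫) := by
    unfold Dfun; ring
  rw [h4, abs_mul]
  refine mul_le_mul ?_ h1 (abs_nonneg _) (by positivity)
  rw [abs_le]
  have := sq_nonneg τ
  constructor <;> nlinarith

lemma aux_Dpoly (τ : ℝ) (x y : E3) : Dfun τ x y = (1 / 4) * ((2 - τ ^ 2)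
    + 2 * (x 0 * y 0 + x 1 * y 1 + x 2 * y 2)
    + τ ^ 2 * (x 0 * y 0 + x 1 * y 1 + x 2 * y 2) ^ 2) := by
  unfold Dfun; rw [aux_inner]; ring

lemma aux_key (τ : ℝ) (ρ : Measure E3) (hmin : IsMinimizer τ ρ) (p x y q : E3)
    (hp : p ∈ msupport ρ) (hx : x ∈ msupport ρ) (hy : y ∈ msupport ρ) (hq : q ∈ msupport ρ)
    (a b A : ℝ) (h1 : ∀ k, |a * (x k - p k) + b * (y k - p k)| ≤ A)
    (h2 : ∀ k l, |a * (x k * x l - p k * p l) + b * (y k * y l - p k * p l)| ≤ A)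
    (hxy : 0 ≤ Dfun τ x y) (hpx : 0 ≤ Dfun τ p x) (hpy : 0 ≤ Dfun τ p y) :
    |a * (Lfun τ x q - Lfun τ p q) + b * (Lfun τ y q - Lfun τ p q)| ≤ (3 + 3 * τ ^ 2) * A ∧
    |a * (Dfun τ x q - Dfun τ p q) + b * (Dfun τ y q - Dfun τ p q)| ≤ (3 + 3 * τ ^ 2) * A := by
  have hS := hmin.2.2.1
  have sp := aux_supp_sphere ρ hS hp
  have sx := aux_supp_sphere ρ hS hx
  have sy := aux_supp_sphere ρ hS hy
  have sq := aux_supp_sphere ρ hS hq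
  have hA : 0 ≤ A := (abs_nonneg _).trans (h1 0)
  have hτ := sq_nonneg τ
  constructor
  · set Λ := a * (Lfun τ x q - Lfun τ p q) + b * (Lfun τ y q - Lfun τ p q) with hΛ
    have hpsd := aux_psd τ ρ hmin ![p, x, y, q] (by
      intro i; fin_cases i <;> simpa) ![-(a + b), a, b, -Λ]
    have Lpp : Lfun τ p p = Dfun τ p p := max_eq_right (by rw [aux_Dself τ p sp]; norm_num)
    have Lxx : Lfun τ x x = Dfun τ x x := max_eq_right (by rw [aux_Dself τ x sx]; norm_num)
    have Lyy : Lfun τ y y = Dfun τ y y := max_eq_right (by rw [aux_Dself τ y sy]; norm_num)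
    have Lqq : Lfun τ q q = 1 := by
      rw [← aux_Dself τ q sq]; exact max_eq_right (by rw [aux_Dself τ q sq]; norm_num)
    have Lxy : Lfun τ x y = Dfun τ x y := max_eq_right hxy
    have Lpx : Lfun τ p x = Dfun τ p x := max_eq_right hpx
    have Lpy : Lfun τ p y = Dfun τ p y := max_eq_right hpy
    simp only [Fin.sum_univ_four, Matrix.cons_val] at hpsd
    rw [aux_Lsymm τ x p, aux_Lsymm τ y p, aux_Lsymm τ y x, aux_Lsymm τ q p, aux_Lsymm τ q x,
      aux_Lsymm τ q y, Lpp, Lxx, Lyy, Lqq, Lxy, Lpx, Lpy] at hpsd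
    have hQ : (a + b) ^ 2 * Dfun τ p p + a ^ 2 * Dfun τ x x + b ^ 2 * Dfun τ y y
        + 2 * a * b * Dfun τ x y - 2 * a * (a + b) * Dfun τ p x - 2 * b * (a + b) * Dfun τ p y
        = (1 / 4) * (2 * ∑ k : Fin 3, (a * (x k - p k) + b * (y k - p k)) ^ 2 +
          τ ^ 2 * ∑ k : Fin 3, ∑ l : Fin 3,
            (a * (x k * x l - p k * p l) + b * (y k * y l - p k * p l)) ^ 2) := by
      simp only [aux_Dpoly, Fin.sum_univ_three]; ring
    have hb1 : ∑ k : Fin 3, (a * (x k - p k) + b * (y k - p k)) ^ 2 ≤ 3 * A ^ 2 := by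
      calc _ ≤ ∑ k : Fin 3, A ^ 2 := Finset.sum_le_sum fun k _ => by
            rw [← sq_abs]; exact pow_le_pow_left₀ (abs_nonneg _) (h1 k) 2
        _ = _ := by simp
    have hb2 : ∑ k : Fin 3, ∑ l : Fin 3,
        (a * (x k * x l - p k * p l) + b * (y k * y l - p k * p l)) ^ 2 ≤ 9 * A ^ 2 := by
      calc _ ≤ ∑ k : Fin 3, ∑ l : Fin 3, A ^ 2 :=
            Finset.sum_le_sum fun k _ => Finset.sum_le_sum fun l _ => by
            rw [← sq_abs]; exact pow_le_pow_left₀ (abs_nonneg _) (h2 k l) 2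
        _ = _ := by simp; ring
    have h3 : Λ ^ 2 ≤ (1 / 4) * (6 * A ^ 2 + τ ^ 2 * (9 * A ^ 2)) := by
      have e1 := mul_le_mul_of_nonneg_left hb2 hτ
      have e2 : Λ * Λ = Λ * (a * (Lfun τ x q - Lfun τ p q) + b * (Lfun τ y q - Lfun τ p q)) := by
        rw [← hΛ]
      nlinarith
    refine abs_le_of_sq_le_sq ?_ (by positivity)
    have hAA := sq_nonneg A
    have : (1 / 4) * (6 * A ^ 2 + τ ^ 2 * (9 * A ^ 2)) ≤ ((3 + 3 * τ ^ 2) * A) ^ 2 := by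
      have e : ((3 + 3 * τ ^ 2) * A) ^ 2 = 9 * A ^ 2 + 18 * (τ ^ 2 * A ^ 2) + 9 * ((τ ^ 2) ^ 2 * A ^ 2) := by
        ring
      have : 0 ≤ τ ^ 2 * A ^ 2 := by positivity
      have : 0 ≤ (τ ^ 2) ^ 2 * A ^ 2 := by positivity
      nlinarith
    linarith
  · have hD : a * (Dfun τ x q - Dfun τ p q) + b * (Dfun τ y q - Dfun τ p q) =
        (1 / 4) * (2 * ∑ k : Fin 3, (a * (x k - p k) + b * (y k - p k)) * q k +
          τ ^ 2 * ∑ k : Fin 3, ∑ l : Fin 3,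
            (a * (x k * x l - p k * p l) + b * (y k * y l - p k * p l)) * (q k * q l)) := by
      simp only [aux_Dpoly, Fin.sum_univ_three]; ring
    have hb1 : |∑ k : Fin 3, (a * (x k - p k) + b * (y k - p k)) * q k| ≤ 3 * A := by
      calc _ ≤ ∑ k : Fin 3, A := (Finset.abs_sum_le_sum_abs _ _).trans
            (Finset.sum_le_sum fun k _ => by
              rw [abs_mul]
              exact (mul_le_mul (h1 k) (aux_coord q sq k) (abs_nonneg _) hA).trans (by simp))
        _ = _ := by simp
    have hb2 : |∑ k : Fin 3, ∑ l : Fin 3,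
        (a * (x k * x l - p k * p l) + b * (y k * y l - p k * p l)) * (q k * q l)| ≤ 9 * A := by
      calc _ ≤ ∑ k : Fin 3, ∑ l : Fin 3, A := (Finset.abs_sum_le_sum_abs _ _).trans
            (Finset.sum_le_sum fun k _ => (Finset.abs_sum_le_sum_abs _ _).trans
              (Finset.sum_le_sum fun l _ => by
              rw [abs_mul, abs_mul]
              have := mul_le_mul (aux_coord q sq k) (aux_coord q sq l) (abs_nonneg _) zero_le_one
              exact (mul_le_mul (h2 k l) this (by positivity) hA).trans (by simp)))
        _ = _ := by simp; ring
    rw [hD]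
    have fin : ∀ X Y : ℝ, |X| ≤ 3 * A → |Y| ≤ 9 * A →
        |(1 / 4) * (2 * X + τ ^ 2 * Y)| ≤ (3 + 3 * τ ^ 2) * A := by
      intro X Y hX hY
      rw [abs_le] at hX hY
      have e1 := mul_le_mul_of_nonneg_left hY.1 hτ
      have e2 := mul_le_mul_of_nonneg_left hY.2 hτ
      have : 0 ≤ τ ^ 2 * A := by positivity
      rw [abs_le]
      constructor <;> linarith
    exact fin _ _ hb1 hb2

lemma aux_taylor (δ : ℝ) (hδ : 0 < δ) (γ : ℝ → E3)
    (hsm : ∀ n : ℕ, ContDiffOn ℝ n γ (Set.Ioo (-δ) δ)) :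
    ∃ C r : ℝ, 0 < C ∧ 0 < r ∧ ∀ t, |t| < r → ‖γ t - γ 0 - t • deriv γ 0‖ ≤ C * t ^ 2 := by
  have hopen : IsOpen (Set.Ioo (-δ) δ) := isOpen_Ioo
  have h2 : ContDiffOn ℝ 2 γ (Set.Ioo (-δ) δ) := by exact_mod_cast hsm 2
  have hd1 : ContDiffOn ℝ 1 (deriv γ) (Set.Ioo (-δ) δ) :=
    ((contDiffOn_succ_iff_deriv_of_isOpen (n := 1) hopen).1
      (by exact_mod_cast h2)).2.2
  have hdd : DifferentiableAt ℝ (deriv γ) 0 :=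
    (hd1.differentiableOn (by norm_num)).differentiableAt
      (hopen.mem_nhds ⟨by linarith, hδ⟩)
  obtain ⟨C, hC, hb⟩ := hdd.hasDerivAt.isBigO_sub.exists_pos
  rw [Asymptotics.IsBigOWith, Metric.eventually_nhds_iff] at hb
  obtain ⟨e, he, hb⟩ := hb
  refine ⟨C, min e δ, hC, lt_min he hδ, fun t ht => ?_⟩
  have hte := ht.trans_le (min_le_left _ _)
  have htd := ht.trans_le (min_le_right _ _)
  have key := Convex.norm_image_sub_le_of_norm_hasDerivWithin_le
    (f := fun u => γ u - u • deriv γ 0) (f' := fun u => deriv γ u - deriv γ 0)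
    (s := Metric.closedBall (0:ℝ) |t|) (x := 0) (y := t) (C := C * |t|) ?_ ?_
    (convex_closedBall _ _) (by simp) (by simp)
  · simp only [zero_smul, sub_zero, Real.norm_eq_abs] at key
    have e1 : γ t - t • deriv γ 0 - γ 0 = γ t - γ 0 - t • deriv γ 0 := by abel
    rw [e1, mul_assoc, ← sq, sq_abs] at key
    exact key
  · intro u hu
    have hu' : |u| ≤ |t| := by simpa using hu
    have hu2 := abs_lt.1 (hu'.trans_lt htd)
    have : DifferentiableAt ℝ γ u := (h2.differentiableOn (by norm_num)).differentiableAt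
      (hopen.mem_nhds ⟨hu2.1, hu2.2⟩)
    have h := this.hasDerivAt.sub ((hasDerivAt_id u).smul_const (deriv γ 0))
    simp only [one_smul] at h
    exact h.hasDerivWithinAt
  · intro u hu
    have hu' : |u| ≤ |t| := by simpa using hu
    have := @hb u (by simpa using hu'.trans_lt hte)
    rw [sub_zero, Real.norm_eq_abs] at this
    exact this.trans (mul_le_mul_of_nonneg_left hu' hC.le)

lemma aux_lam (C f0 f1 fx fy s t : ℝ) (hs : 0 < s) (ht : 0 < t)
    (hx : |fx - f0 - t * f1| ≤ C * t ^ 2) (hy : |fy - f0 + s * f1| ≤ C * s ^ 2) :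
    |1 / t * (fx - f0) + 1 / s * (fy - f0)| ≤ C * (s + t) := by
  have e : 1 / t * (fx - f0) + 1 / s * (fy - f0) =
      (fx - f0 - t * f1) / t + (fy - f0 + s * f1) / s := by field_simp; ring
  rw [e]
  refine (abs_add_le _ _).trans ?_
  rw [abs_div, abs_div, abs_of_pos hs, abs_of_pos ht]
  have h1 : |fx - f0 - t * f1| / t ≤ C * t := by rw [div_le_iff₀ ht]; linarith
  have h2 : |fy - f0 + s * f1| / s ≤ C * s := by rw [div_le_iff₀ hs]; linarith
  linarith

lemma aux_prod (C f0 f1 f g0 g1 g t : ℝ) (hC : 0 < C) (ht : |t| ≤ 1)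
    (hf0 : |f0| ≤ 1) (hf1 : |f1| ≤ 1) (hg0 : |g0| ≤ 1) (hg1 : |g1| ≤ 1)
    (hf : |f - f0 - t * f1| ≤ C * t ^ 2) (hg : |g - g0 - t * g1| ≤ C * t ^ 2) :
    |f * g - f0 * g0 - t * (f0 * g1 + f1 * g0)| ≤ (2 * C + (1 + C) ^ 2) * t ^ 2 := by
  set R := f - f0 - t * f1 with hR
  set Q := g - g0 - t * g1 with hQ
  have e : f * g - f0 * g0 - t * (f0 * g1 + f1 * g0) =
      f0 * Q + R * g0 + (t * f1 + R) * (t * g1 + Q) := by rw [hR, hQ]; ring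
  have hT : t ^ 2 ≤ |t| := by
    rw [← sq_abs]; nlinarith [abs_nonneg t]
  have hB : ∀ u P, |u| ≤ 1 → |P| ≤ C * t ^ 2 → |t * u + P| ≤ (1 + C) * |t| := by
    intro u P hu hP
    refine (abs_add_le _ _).trans ?_
    rw [abs_mul]
    have := mul_le_mul_of_nonneg_left hu (abs_nonneg t)
    have := mul_le_mul_of_nonneg_left hT hC.le
    linarith
  have h1 : |f0 * Q| ≤ C * t ^ 2 := by
    rw [abs_mul]; exact (mul_le_mul hf0 hg (abs_nonneg _) zero_le_one).trans (by simp)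
  have h2 : |R * g0| ≤ C * t ^ 2 := by
    rw [abs_mul]; exact (mul_le_mul hf hg0 (abs_nonneg _) (by positivity)).trans (by simp)
  have h3 : |(t * f1 + R) * (t * g1 + Q)| ≤ (1 + C) ^ 2 * t ^ 2 := by
    rw [abs_mul]
    refine (mul_le_mul (hB _ _ hf1 hf) (hB _ _ hg1 hg) (abs_nonneg _) (by positivity)).trans ?_
    rw [← sq_abs t]; apply le_of_eq; ring
  rw [e]
  refine (abs_add_le _ _).trans ((add_le_add (abs_add_le _ _) le_rfl).trans ?_)
  linarith

/-- The excess of the Lagrangian over the truncated polynomial. -/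
noncomputable def Efun (τ : ℝ) (p x q : E3) : ℝ :=
  Lfun τ x q - {q | 0 < Dfun τ p q}.indicator (fun q => Dfun τ x q) q

/-- Comparison curve. -/
noncomputable def Xc (u : ℝ) : E3 := mkE3 (Real.sqrt (1 - u ^ 2)) u 0

lemma aux_mk0 (a b c : ℝ) : mkE3 a b c 0 = a := rfl
lemma aux_mk1 (a b c : ℝ) : mkE3 a b c 1 = b := rfl
lemma aux_mk2 (a b c : ℝ) : mkE3 a b c 2 = c := rfl

lemma aux_mk_sph (a b c : ℝ) (h : a ^ 2 + b ^ 2 + c ^ 2 = 1) : mkE3 a b c ∈ Sphere2 := by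
  simp only [Sphere2, mem_sphere_iff_norm, sub_zero]
  rw [EuclideanSpace.norm_eq, Fin.sum_univ_three, aux_mk0, aux_mk1, aux_mk2]
  simp [h]

lemma aux_X_sph (u : ℝ) (hu : |u| ≤ 1) : Xc u ∈ Sphere2 := by
  apply aux_mk_sph
  have : u ^ 2 ≤ 1 := by rw [← sq_abs]; nlinarith [abs_nonneg u]
  rw [Real.sq_sqrt (by linarith)]; ring

lemma aux_E_pos (τ : ℝ) (p x q : E3) (h : 0 < Dfun τ p q) :
    Efun τ p x q = Lfun τ x q - Dfun τ x q := by
  unfold Efun; rw [indicator_of_mem]; exact h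

lemma aux_E_neg (τ : ℝ) (p x q : E3) (h : ¬ 0 < Dfun τ p q) :
    Efun τ p x q = Lfun τ x q := by
  unfold Efun; rw [indicator_of_notMem, sub_zero]; exact h

lemma aux_E_nonneg (τ : ℝ) (p x q : E3) : 0 ≤ Efun τ p x q := by
  by_cases h : 0 < Dfun τ p q
  · rw [aux_E_pos _ _ _ _ h, sub_nonneg]; exact le_max_right _ _
  · rw [aux_E_neg _ _ _ _ h]; exact aux_Lnonneg _ _ _

lemma aux_E_lip (τ : ℝ) (p x y q : E3) (hx : x ∈ Sphere2) (hy : y ∈ Sphere2) (hq : q ∈ Sphere2) :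
    Efun τ p x q ≤ Efun τ p y q + 2 * (1 + τ ^ 2) * ‖x - y‖ := by
  have h1 := aux_Dlip τ x y q hx hy hq
  have h2 : |Lfun τ x q - Lfun τ y q| ≤ |Dfun τ x q - Dfun τ y q| := by
    unfold Lfun
    have := abs_max_sub_max_le_max 0 (Dfun τ x q) 0 (Dfun τ y q)
    simpa using this
  have h3 := abs_le.1 (h2.trans h1)
  have h4 := abs_le.1 h1
  by_cases h : 0 < Dfun τ p q
  · rw [aux_E_pos _ _ _ _ h, aux_E_pos _ _ _ _ h]; linarith [h3.2, h4.1]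
  · rw [aux_E_neg _ _ _ _ h, aux_E_neg _ _ _ _ h]
    have := (abs_nonneg _).trans h1
    linarith [h3.2]

set_option maxHeartbeats 1000000 in
lemma aux_near (τ δ : ℝ) (ρ : Measure E3) (hmin : IsMinimizer τ ρ) (hδ : 0 < δ)
    (γ : ℝ → E3) (hsm : ∀ n : ℕ, ContDiffOn ℝ n γ (Set.Ioo (-δ) δ))
    (h0 : γ 0 = mkE3 1 0 0) (h1 : deriv γ 0 = mkE3 0 1 0)
    (hpM : mkE3 1 0 0 ∈ msupport ρ) :
    ∃ K r : ℝ, 0 < K ∧ 0 < r ∧ r ≤ 1 ∧ (∀ t, |t| < r → ‖Xc t - γ t‖ ≤ K * t ^ 2) ∧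
      ∀ s t, 0 < s → s < r → 0 < t → t < r → γ (-s) ∈ msupport ρ → γ t ∈ msupport ρ →
      ∀ q ∈ msupport ρ, 1 / t * Efun τ (mkE3 1 0 0) (γ t) q +
        1 / s * Efun τ (mkE3 1 0 0) (γ (-s)) q ≤ K * (s + t) := by
  have hS := hmin.2.2.1
  obtain ⟨C, r0, hC, hr0, hT⟩ := aux_taylor δ hδ γ hsm
  rw [h0, h1] at hT
  set p := mkE3 1 0 0 with hp
  set e := mkE3 0 1 0 with he
  have hpS : p ∈ Sphere2 := aux_supp_sphere ρ hS hpM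
  have heS : e ∈ Sphere2 := aux_mk_sph _ _ _ (by norm_num)
  have hk : ∀ t, |t| < r0 → ∀ k, |γ t k - p k - t * e k| ≤ C * t ^ 2 := by
    intro t ht k
    have := (PiLp.norm_apply_le (γ t - p - t • e) k).trans (hT t ht)
    simpa using this
  set C2 := 2 * C + (1 + C) ^ 2 with hC2
  have hC2p : 0 < C2 := by positivity
  set K := 2 * (3 + 3 * τ ^ 2) * C2 + (C + 1) with hK
  set r := min r0 (min 1 (1 / (2 * (1 + τ ^ 2) * (1 + C)))) with hr
  have hrr0 : r ≤ r0 := min_le_left _ _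
  have hr1 : r ≤ 1 := (min_le_right _ _).trans (min_le_left _ _)
  have hr2 : r * (2 * (1 + τ ^ 2) * (1 + C)) ≤ 1 := by
    rw [← le_div_iff₀ (by positivity)]; exact (min_le_right _ _).trans (min_le_right _ _)
  have hrpos : 0 < r := lt_min hr0 (lt_min one_pos (by positivity))
  have hdist : ∀ t, |t| < r → ‖γ t - p‖ ≤ (1 + C) * r := by
    intro t ht
    have h3 := hT t (ht.trans_le hrr0)
    have h4 : ‖γ t - p‖ ≤ ‖γ t - p - t • e‖ + ‖t • e‖ := by
      simpa using norm_add_le (γ t - p - t • e) (t • e)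
    rw [norm_smul, aux_sph e heS, Real.norm_eq_abs, mul_one] at h4
    have h5 : t ^ 2 ≤ r := by rw [← sq_abs]; nlinarith [abs_nonneg t]
    nlinarith
  refine ⟨K, r, by positivity, hrpos, hr1, ?_, ?_⟩
  · intro t ht
    have ht1 : |t| ≤ 1 := ht.le.trans hr1
    have h3 := hT t (ht.trans_le hrr0)
    have h4 : Xc t - p - t • e = (Real.sqrt (1 - t ^ 2) - 1) • p := by
      ext k; fin_cases k <;> simp [Xc, hp, he, mkE3]
    have h5 : ‖Xc t - p - t • e‖ ≤ t ^ 2 := by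
      rw [h4, norm_smul, aux_sph p hpS, mul_one, Real.norm_eq_abs, abs_le]
      have ht2 : t ^ 2 ≤ 1 := by rw [← sq_abs]; nlinarith [abs_nonneg t]
      have hs1 : Real.sqrt (1 - t ^ 2) ≤ 1 := Real.sqrt_le_one.2 (by nlinarith)
      have hs0 := Real.sqrt_nonneg (1 - t ^ 2)
      have hs2 := Real.sq_sqrt (show 0 ≤ 1 - t ^ 2 by linarith)
      constructor <;> nlinarith
    have h6 : Xc t - γ t = (Xc t - p - t • e) - (γ t - p - t • e) := by abel
    rw [h6]
    refine (norm_sub_le _ _).trans ?_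
    have : 0 ≤ (3 + 3 * τ ^ 2) * C2 * t ^ 2 := by positivity
    rw [hK]; nlinarith
  · intro s t hs hsr ht htr hsM htM q hq
    have sx := aux_supp_sphere ρ hS htM
    have sy := aux_supp_sphere ρ hS hsM
    have hta : |t| < r := by rwa [abs_of_pos ht]
    have hsa : |(-s)| < r := by rwa [abs_neg, abs_of_pos hs]
    have dx := hdist t hta
    have dy := hdist (-s) hsa
    have kx := hk t (hta.trans_le hrr0)
    have ky := hk (-s) (hsa.trans_le hrr0)
    have hpc := aux_coord p hpS
    have hec := aux_coord e heS
    have hCC2 : C ≤ C2 := by rw [hC2]; nlinarith [sq_nonneg (1 + C)]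
    have Dnear : ∀ x y, x ∈ Sphere2 → y ∈ Sphere2 → ‖x - y‖ ≤ 2 * ((1 + C) * r) →
        0 ≤ Dfun τ x y := by
      intro x y hx hy hxy
      have l := (abs_le.1 (aux_Dlip τ x y y hx hy hy)).1
      rw [aux_Dself τ y hy] at l
      have : (1 + τ ^ 2) * ‖x - y‖ ≤ (1 + τ ^ 2) * (2 * ((1 + C) * r)) :=
        mul_le_mul_of_nonneg_left hxy (by positivity)
      nlinarith
    have nn : 0 ≤ (1 + C) * r := by positivity
    have hkey := aux_key τ ρ hmin p (γ t) (γ (-s)) q hpM htM hsM hq (1 / t) (1 / s)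
      (C2 * (s + t))
      (fun k => by
        have := aux_lam C (p k) (e k) (γ t k) (γ (-s) k) s t hs ht (kx k)
          (by have := ky k; rw [neg_sq] at this; convert this using 2; ring)
        refine this.trans (mul_le_mul_of_nonneg_right hCC2 (by positivity)))
      (fun k l => by
        refine aux_lam C2 (p k * p l) (p k * e l + e k * p l) _ _ s t hs ht
          (aux_prod C (p k) (e k) (γ t k) (p l) (e l) (γ t l) t hC (hta.le.trans hr1)
            (hpc k) (hec k) (hpc l) (hec l) (kx k) (kx l)) ?_
        have := aux_prod C (p k) (e k) (γ (-s) k) (p l) (e l) (γ (-s) l) (-s) hC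
          (hsa.le.trans hr1) (hpc k) (hec k) (hpc l) (hec l) (ky k) (ky l)
        rw [neg_sq] at this
        convert this using 2; ring)
      (Dnear _ _ sx sy (by
        have e1 : γ t - γ (-s) = (γ t - p) - (γ (-s) - p) := by abel
        rw [e1]; refine (norm_sub_le _ _).trans ?_; linarith))
      (Dnear _ _ hpS sx (by rw [norm_sub_rev]; linarith))
      (Dnear _ _ hpS sy (by rw [norm_sub_rev]; linarith))
    have k1 := abs_le.1 hkey.1
    have k2 := abs_le.1 hkey.2
    have hst : 0 ≤ (C + 1) * (s + t) := by positivity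
    have hKK : 2 * ((3 + 3 * τ ^ 2) * (C2 * (s + t))) ≤ K * (s + t) := by
      have e : K * (s + t) = 2 * ((3 + 3 * τ ^ 2) * (C2 * (s + t))) + (C + 1) * (s + t) := by
        rw [hK]; ring
      linarith
    have hnn : 0 ≤ (3 + 3 * τ ^ 2) * (C2 * (s + t)) := by positivity
    by_cases h : 0 < Dfun τ p q
    · rw [aux_E_pos _ _ _ _ h, aux_E_pos _ _ _ _ h]
      have : Lfun τ p q = Dfun τ p q := max_eq_right h.le
      rw [this] at k1
      have e : 1 / t * (Lfun τ (γ t) q - Dfun τ (γ t) q) +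
          1 / s * (Lfun τ (γ (-s)) q - Dfun τ (γ (-s)) q) =
          (1 / t * (Lfun τ (γ t) q - Dfun τ p q) + 1 / s * (Lfun τ (γ (-s)) q - Dfun τ p q)) -
          (1 / t * (Dfun τ (γ t) q - Dfun τ p q) + 1 / s * (Dfun τ (γ (-s)) q - Dfun τ p q)) := by
        ring
      rw [e]
      linarith [k1.2, k2.1]
    · rw [aux_E_neg _ _ _ _ h, aux_E_neg _ _ _ _ h]
      have : Lfun τ p q = 0 := max_eq_left (not_lt.1 h)
      rw [this, sub_zero, sub_zero] at k1
      linarith [k1.2]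

lemma aux_lim0 (Θ : ℝ → ℝ) (hΘ : ContinuousAt Θ 0) (s t : ℕ → ℝ)
    (hs : Filter.Tendsto s Filter.atTop (nhds 0)) (ht : Filter.Tendsto t Filter.atTop (nhds 0))
    (C : ℝ) (h1 : ∀ n, Θ (t n) ≤ C * (s n + t n)) (h2 : ∀ n, -(C * (s n + t n)) ≤ Θ (-s n)) :
    Θ 0 = 0 := by
  have hb : Filter.Tendsto (fun n => C * (s n + t n)) Filter.atTop (nhds 0) := by
    simpa using (hs.add ht).const_mul C
  have a1 : Filter.Tendsto (fun n => Θ (t n)) Filter.atTop (nhds (Θ 0)) := hΘ.tendsto.comp ht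
  have hs2 : Filter.Tendsto (fun n => - s n) Filter.atTop (nhds 0) := by simpa using hs.neg
  have a2 : Filter.Tendsto (fun n => Θ (-s n)) Filter.atTop (nhds (Θ 0)) := hΘ.tendsto.comp hs2
  have b1 := le_of_tendsto_of_tendsto' a1 hb h1
  have b2 := le_of_tendsto_of_tendsto' hb.neg a2 h2
  simp at b2
  linarith

lemma aux_Xc_cont : Continuous Xc := by
  refine (PiLp.continuous_toLp 2 (fun _ : Fin 3 => ℝ)).comp
    (f := fun u : ℝ => ![√(1 - u ^ 2), u, 0]) (continuous_pi fun k => ?_)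
  fin_cases k
  · show Continuous fun u : ℝ => Real.sqrt (1 - u ^ 2)
    fun_prop
  · show Continuous fun u : ℝ => u
    fun_prop
  · show Continuous fun u : ℝ => (0 : ℝ)
    fun_prop

lemma aux_Xc0 : Xc 0 = mkE3 1 0 0 := by simp [Xc]

lemma aux_DX (τ u : ℝ) (q : E3) : Dfun τ (Xc u) q = (1 / 4) * (1 + (√(1 - u ^ 2) * q 0 + u * q 1))
    * (2 - τ ^ 2 * (1 - (√(1 - u ^ 2) * q 0 + u * q 1))) := by
  unfold Dfun; rw [aux_inner]; unfold Xc; rw [aux_mk0, aux_mk1, aux_mk2]; ring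

lemma aux_Dp (τ : ℝ) (q : E3) : Dfun τ (mkE3 1 0 0) q = (1 / 4) * (1 + q 0)
    * (2 - τ ^ 2 * (1 - q 0)) := by
  unfold Dfun; rw [aux_inner]; rw [aux_mk0, aux_mk1, aux_mk2]; ring

lemma aux_c (u : ℝ) (hu : |u| ≤ 1) : √(1 - u ^ 2) ^ 2 = 1 - u ^ 2 ∧ 0 ≤ √(1 - u ^ 2) ∧
    √(1 - u ^ 2) ≤ 1 := by
  have : u ^ 2 ≤ 1 := by rw [← sq_abs]; nlinarith [abs_nonneg u]
  exact ⟨Real.sq_sqrt (by linarith), Real.sqrt_nonneg _, Real.sqrt_le_one.2 (by nlinarith)⟩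

/-- On the boundary of the light cone the second coordinate vanishes. -/
lemma aux_bdry (τ : ℝ) (hτ : 6 < τ ^ 2) (γ : ℝ → E3) (q : E3) (hq : q ∈ Sphere2)
    (hD : Dfun τ (mkE3 1 0 0) q = 0) (K : ℝ) (s t : ℕ → ℝ)
    (hs : Filter.Tendsto s Filter.atTop (nhds 0)) (ht : Filter.Tendsto t Filter.atTop (nhds 0))
    (hs0 : ∀ n, 0 < s n ∧ s n ≤ 1) (ht0 : ∀ n, 0 < t n ∧ t n ≤ 1)
    (hsS : ∀ n, γ (- s n) ∈ Sphere2) (htS : ∀ n, γ (t n) ∈ Sphere2) (hK : 0 < K)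
    (hsX : ∀ n, ‖Xc (- s n) - γ (- s n)‖ ≤ K * (s n) ^ 2)
    (htX : ∀ n, ‖Xc (t n) - γ (t n)‖ ≤ K * (t n) ^ 2)
    (hE : ∀ n, 1 / t n * Efun τ (mkE3 1 0 0) (γ (t n)) q +
        1 / s n * Efun τ (mkE3 1 0 0) (γ (- s n)) q ≤ K * (s n + t n)) : q 1 = 0 := by
  set Θ : ℝ → ℝ := fun u => (1 / 4) * (q 1 - u * q 0 / (1 + √(1 - u ^ 2))) *
    (2 + τ ^ 2 * (√(1 - u ^ 2) * q 0 + u * q 1 + q 0)) with hΘ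
  have hc : Continuous Θ := by
    have : ∀ u : ℝ, 1 + √(1 - u ^ 2) ≠ 0 := fun u => by positivity
    rw [hΘ]
    fun_prop (disch := assumption)
  have hDΘ : ∀ u, |u| ≤ 1 → Dfun τ (Xc u) q = u * Θ u := by
    intro u hu
    obtain ⟨c2, c0, c1⟩ := aux_c u hu
    rw [aux_DX]
    rw [aux_Dp] at hD
    simp only [hΘ]
    set c := √(1 - u ^ 2)
    have hc1 : 1 + c ≠ 0 := by positivity
    have e : u * (q 1 - u * q 0 / (1 + c)) = (c - 1) * q 0 + u * q 1 := by
      field_simp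
      linear_combination (- q 0) * c2
    have : u * ((1 / 4) * (q 1 - u * q 0 / (1 + c)) * (2 + τ ^ 2 * (c * q 0 + u * q 1 + q 0)))
      = (1 / 4) * (u * (q 1 - u * q 0 / (1 + c))) * (2 + τ ^ 2 * (c * q 0 + u * q 1 + q 0)) := by
      ring
    rw [this, e]
    linear_combination hD
  have hEL : ∀ x, Efun τ (mkE3 1 0 0) x q = Lfun τ x q := fun x =>
    aux_E_neg _ _ _ _ (by rw [hD]; exact lt_irrefl _)
  have hb : ∀ n, Θ (t n) ≤ K * (2 + τ ^ 2) * (s n + t n) ∧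
      -(K * (2 + τ ^ 2) * (s n + t n)) ≤ Θ (-s n) := by
    intro n
    have a := hE n
    rw [hEL, hEL] at a
    obtain ⟨hs1, hs2⟩ := hs0 n
    obtain ⟨ht1, ht2⟩ := ht0 n
    have n1 := mul_nonneg (one_div_pos.2 ht1).le (aux_Lnonneg τ (γ (t n)) q)
    have n2 := mul_nonneg (one_div_pos.2 hs1).le (aux_Lnonneg τ (γ (-s n)) q)
    have l1 : Lfun τ (γ (t n)) q ≤ t n * (K * (s n + t n)) := by
      rw [← div_le_iff₀' ht1, div_eq_inv_mul, ← one_div]; linarith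
    have l2 : Lfun τ (γ (-s n)) q ≤ s n * (K * (s n + t n)) := by
      rw [← div_le_iff₀' hs1, div_eq_inv_mul, ← one_div]; linarith
    have at1 : |t n| ≤ 1 := by rwa [abs_of_pos ht1]
    have as1 : |- s n| ≤ 1 := by rwa [abs_neg, abs_of_pos hs1]
    have d1 := (abs_le.1 (aux_Dlip τ _ _ q (aux_X_sph _ at1) (htS n) hq)).2
    have d2 := (abs_le.1 (aux_Dlip τ _ _ q (aux_X_sph _ as1) (hsS n) hq)).2
    have x1 := mul_le_mul_of_nonneg_left (htX n) (show 0 ≤ 1 + τ ^ 2 by positivity)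
    have x2 := mul_le_mul_of_nonneg_left (hsX n) (show 0 ≤ 1 + τ ^ 2 by positivity)
    have y1 : Dfun τ (γ (t n)) q ≤ Lfun τ (γ (t n)) q := le_max_right _ _
    have y2 : Dfun τ (γ (-s n)) q ≤ Lfun τ (γ (-s n)) q := le_max_right _ _
    rw [hDΘ _ at1] at d1
    rw [hDΘ _ as1] at d2
    have z : 0 ≤ (1 + τ ^ 2) * K * (s n * t n) := by positivity
    constructor
    · refine le_of_mul_le_mul_left ?_ ht1
      have : t n * (K * (2 + τ ^ 2) * (s n + t n)) = t n * (K * (s n + t n)) +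
        (1 + τ ^ 2) * (K * t n ^ 2) + (1 + τ ^ 2) * K * (s n * t n) := by ring
      linarith
    · have w : s n * (- Θ (- s n)) ≤ s n * (K * (2 + τ ^ 2) * (s n + t n)) := by
        have : s n * (K * (2 + τ ^ 2) * (s n + t n)) = s n * (K * (s n + t n)) +
          (1 + τ ^ 2) * (K * s n ^ 2) + (1 + τ ^ 2) * K * (s n * t n) := by ring
        linarith
      have := le_of_mul_le_mul_left w hs1
      linarith
  have h0 := aux_lim0 Θ hc.continuousAt s t hs ht _ (fun n => (hb n).1) (fun n => (hb n).2)
  have e0 : Θ 0 = (1 / 4) * q 1 * (2 + τ ^ 2 * (2 * q 0)) := by simp [hΘ]; ring_nf; simp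
  rw [e0] at h0
  rw [aux_Dp] at hD
  by_contra h
  have h2 : 2 + τ ^ 2 * (2 * q 0) = 0 := by
    rcases mul_eq_zero.1 h0 with h' | h'
    · exact absurd (by linarith) h
    · exact h'
  have : (1 + q 0) * (2 - τ ^ 2 * (1 - q 0)) = 0 := by linarith
  rcases mul_eq_zero.1 this with h' | h'
  · have : q 0 = -1 := by linarith
    rw [this] at h2; linarith
  · nlinarith

/-- Pointwise vanishing of the excess. -/
lemma aux_evzero (τ : ℝ) (hτ : 6 < τ ^ 2) (q : E3)
    (hD : Dfun τ (mkE3 1 0 0) q = 0 → q 1 = 0) (σ : ℕ → ℝ)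
    (hσ : Filter.Tendsto σ Filter.atTop (nhds 0)) (hσ1 : ∀ n, |σ n| ≤ 1) :
    ∀ᶠ n in Filter.atTop, Efun τ (mkE3 1 0 0) (Xc (σ n)) q = 0 := by
  have hc : Continuous fun u => Dfun τ (Xc u) q :=
    (aux_Dcont τ).comp (aux_Xc_cont.prodMk continuous_const)
  have ht : Filter.Tendsto (fun n => Dfun τ (Xc (σ n)) q) Filter.atTop
      (nhds (Dfun τ (mkE3 1 0 0) q)) := by
    rw [← aux_Xc0]; exact (hc.tendsto 0).comp hσ
  rcases lt_trichotomy (Dfun τ (mkE3 1 0 0) q) 0 with h | h | h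
  · filter_upwards [ht.eventually_lt_const h] with n hn
    rw [aux_E_neg _ _ _ _ h.not_gt]; exact max_eq_left hn.le
  · refine Filter.Eventually.of_forall fun n => ?_
    rw [aux_E_neg _ _ _ _ (by rw [h]; exact lt_irrefl _)]
    refine max_eq_left ?_
    rw [aux_DX, hD h]
    obtain ⟨c2, c0, c1⟩ := aux_c _ (hσ1 n)
    rw [aux_Dp] at h
    set c := √(1 - (σ n) ^ 2)
    have : (1 + q 0) * (2 - τ ^ 2 * (1 - q 0)) = 0 := by linarith
    rw [mul_zero, add_zero]
    rcases mul_eq_zero.1 this with h' | h'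
    · have e : q 0 = -1 := by linarith
      rw [e]
      have : 0 ≤ (1 - c) * (τ ^ 2 * (1 + c) - 2) := mul_nonneg (by linarith) (by nlinarith)
      nlinarith
    · have q0p : 0 ≤ q 0 := by nlinarith
      have a1 : 0 ≤ 1 + c * q 0 := by positivity
      have a2 : 2 - τ ^ 2 * (1 - c * q 0) ≤ 0 := by
        have : 0 ≤ τ ^ 2 * ((1 - c) * q 0) := by
          have := sub_nonneg.2 c1
          positivity
        nlinarith
      have := mul_nonneg a1 (neg_nonneg.2 a2)
      nlinarith
  · filter_upwards [ht.eventually_const_lt h] with n hn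
    rw [aux_E_pos _ _ _ _ h, sub_eq_zero]; exact max_eq_right hn.le

lemma aux_final (τ m B0 B1 Q00 Q01 Q11 S A : ℝ) (hτ : 6 < τ ^ 2) (hm : 0 < m) (hS : 0 ≤ S)
    (hQ : Q11 ≤ m - Q00) (hQ0 : m * (1 - 2 / τ ^ 2) ^ 2 ≤ Q00) (f : ℝ → ℝ)
    (hf : ∀ t, f t = (1 / 4) * ((2 - τ ^ 2) * m + 2 * (√(1 - t ^ 2) * B0 + t * B1) +
      τ ^ 2 * (√(1 - t ^ 2) ^ 2 * Q00 + 2 * √(1 - t ^ 2) * t * Q01 + t ^ 2 * Q11)))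
    (hf0 : f 0 = S) (s t σ e : ℕ → ℝ)
    (hs : Filter.Tendsto s Filter.atTop (nhds 0)) (ht : Filter.Tendsto t Filter.atTop (nhds 0))
    (hσ : Filter.Tendsto σ Filter.atTop (nhds 0)) (he : Filter.Tendsto e Filter.atTop (nhds 0))
    (hs0 : ∀ n, 0 < s n ∧ s n ≤ 1) (ht0 : ∀ n, 0 < t n ∧ t n ≤ 1)
    (hσ0 : ∀ n, σ n ≠ 0 ∧ |σ n| ≤ 1) (hA : 0 ≤ A)
    (hft : ∀ n, f (t n) ≤ S + A * (t n) ^ 2) (hfs : ∀ n, f (- s n) ≤ S + A * (s n) ^ 2)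
    (hfe : ∀ n, S ≤ f (σ n) + e n * (σ n) ^ 2) : False := by
  have hne : ∀ u : ℝ, 1 + √(1 - u ^ 2) ≠ 0 := fun u => by positivity
  have hS4 : (2 - τ ^ 2) * m + 2 * B0 + τ ^ 2 * Q00 = 4 * S := by
    rw [← hf0, hf]; norm_num; ring
  set Ψ : ℝ → ℝ := fun u => (1 / 4) * (- 2 * B0 * u / (1 + √(1 - u ^ 2)) +
    2 * (B1 + τ ^ 2 * √(1 - u ^ 2) * Q01) + τ ^ 2 * u * (Q11 - Q00)) with hΨ
  have hΨc : Continuous Ψ := by rw [hΨ]; fun_prop (disch := assumption)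
  have hfΨ : ∀ u, |u| ≤ 1 → f u = S + u * Ψ u := by
    intro u hu
    obtain ⟨c2, c0, c1⟩ := aux_c u hu
    rw [hf]
    simp only [hΨ]
    have h1 := hne u
    set c := √(1 - u ^ 2)
    have e1 : u * (- 2 * B0 * u / (1 + c)) = 2 * B0 * (c - 1) := by
      field_simp
      linear_combination (-B0) * c2
    linear_combination (1 / 4) * hS4 - (1 / 4) * e1 + (1 / 4) * τ ^ 2 * Q00 * c2
  have hΨ0 := aux_lim0 Ψ hΨc.continuousAt s t hs ht A (fun n => by
      obtain ⟨h1, h2⟩ := ht0 n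
      have h3 := hft n
      rw [hfΨ _ (by rwa [abs_of_pos h1])] at h3
      have h4 : t n * Ψ (t n) ≤ t n * (A * t n) := by nlinarith
      have h5 := le_of_mul_le_mul_left h4 h1
      have := mul_nonneg hA (hs0 n).1.le
      linarith) (fun n => by
      obtain ⟨h1, h2⟩ := hs0 n
      have h3 := hfs n
      rw [hfΨ _ (by rwa [abs_neg, abs_of_pos h1])] at h3
      have h4 : s n * (- Ψ (- s n)) ≤ s n * (A * s n) := by nlinarith
      have h5 := le_of_mul_le_mul_left h4 h1
      have := mul_nonneg hA (ht0 n).1.le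
      linarith)
  have hB1 : B1 = - τ ^ 2 * Q01 := by
    simp [hΨ] at hΨ0; linarith
  set Ω : ℝ → ℝ := fun u => (1 / 4) * (- (2 * B0 + 2 * τ ^ 2 * Q01 * u) / (1 + √(1 - u ^ 2)) +
    τ ^ 2 * (Q11 - Q00)) with hΩ
  have hΩc : Continuous Ω := by rw [hΩ]; fun_prop (disch := assumption)
  have hfΩ : ∀ u, |u| ≤ 1 → f u = S + u ^ 2 * Ω u := by
    intro u hu
    obtain ⟨c2, c0, c1⟩ := aux_c u hu
    rw [hf]
    simp only [hΩ]
    have h1 := hne u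
    set c := √(1 - u ^ 2)
    have e1 : u ^ 2 * (- (2 * B0 + 2 * τ ^ 2 * Q01 * u) / (1 + c)) =
        (2 * B0 + 2 * τ ^ 2 * Q01 * u) * (c - 1) := by
      field_simp
      linear_combination (- 1) * (B0 + τ ^ 2 * Q01 * u) * c2
    rw [hB1]
    linear_combination (1 / 4) * hS4 - (1 / 4) * e1 + (1 / 4) * τ ^ 2 * Q00 * c2
  have hlim : Filter.Tendsto (fun n => Ω (σ n) + e n) Filter.atTop (nhds (Ω 0 + 0)) :=
    ((hΩc.tendsto 0).comp hσ).add he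
  have hpos : 0 ≤ Ω 0 + 0 := ge_of_tendsto' hlim fun n => by
    have h3 := hfe n
    rw [hfΩ _ (hσ0 n).2] at h3
    have h4 : 0 < σ n ^ 2 := by have := (hσ0 n).1; positivity
    by_contra hneg
    push Not at hneg
    nlinarith
  have hΩ0 : Ω 0 = (1 / 4) * (- B0 + τ ^ 2 * (Q11 - Q00)) := by
    simp [hΩ]; ring
  rw [hΩ0] at hpos
  have hT : 0 < τ ^ 2 := by linarith
  have q1 : τ ^ 2 * Q11 ≤ τ ^ 2 * (m - Q00) := mul_le_mul_of_nonneg_left hQ hT.le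
  have q2 : τ ^ 2 * (τ ^ 2 * (m * (1 - 2 / τ ^ 2) ^ 2)) ≤ τ ^ 2 * (τ ^ 2 * Q00) := by gcongr
  have q3 : τ ^ 2 * (τ ^ 2 * (m * (1 - 2 / τ ^ 2) ^ 2)) = m * (τ ^ 2 - 2) ^ 2 := by
    have q0 : τ ^ 2 * (1 - 2 / τ ^ 2) = τ ^ 2 - 2 := by
      rw [mul_sub, mul_one, mul_div_cancel₀ _ hT.ne']
    rw [← q0]; ring
  have q4 : 3 * (τ ^ 2 * Q00) ≤ (τ ^ 2 + 2) * m := by nlinarith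
  have q5 : τ ^ 2 * (3 * (τ ^ 2 * Q00)) ≤ τ ^ 2 * ((τ ^ 2 + 2) * m) := by gcongr
  have q6 : 0 < m * ((τ ^ 2 - 1) * (τ ^ 2 - 6)) :=
    mul_pos hm (mul_pos (by linarith) (by linarith))
  nlinarith

lemma aux_F (τ : ℝ) (ν : Measure E3) (hi : ∀ f : E3 → ℝ, Continuous f → Integrable f ν) (u : ℝ) :
    ∫ q, Dfun τ (Xc u) q ∂ν = (1 / 4) * ((2 - τ ^ 2) * (∫ _, (1 : ℝ) ∂ν) +
      2 * (√(1 - u ^ 2) * (∫ q, q 0 ∂ν) + u * (∫ q, q 1 ∂ν)) +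
      τ ^ 2 * (√(1 - u ^ 2) ^ 2 * (∫ q, q 0 ^ 2 ∂ν) + 2 * √(1 - u ^ 2) * u * (∫ q, q 0 * q 1 ∂ν)
        + u ^ 2 * (∫ q, q 1 ^ 2 ∂ν))) := by
  set c := √(1 - u ^ 2) with hc
  have e : ∀ q, Dfun τ (Xc u) q = (1 / 4 * (2 - τ ^ 2)) * 1 + (1 / 2 * c) * q 0 + (1 / 2 * u) * q 1
      + (τ ^ 2 / 4 * c ^ 2) * q 0 ^ 2 + (τ ^ 2 / 2 * c * u) * (q 0 * q 1)
      + (τ ^ 2 / 4 * u ^ 2) * q 1 ^ 2 := by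
    intro q; rw [aux_DX, ← hc]; ring
  simp_rw [e]
  rw [integral_add (hi _ (by fun_prop)) (hi _ (by fun_prop)),
    integral_add (hi _ (by fun_prop)) (hi _ (by fun_prop)),
    integral_add (hi _ (by fun_prop)) (hi _ (by fun_prop)),
    integral_add (hi _ (by fun_prop)) (hi _ (by fun_prop)),
    integral_add (hi _ (by fun_prop)) (hi _ (by fun_prop))]
  simp only [integral_const_mul]
  ring

lemma aux_seq (M : Set E3) (β δ : ℝ) (γ : ℝ → E3) (hacc : UniformTwoSidedAcc M β δ γ) (r : ℝ)
    (hr : 0 < r) : ∃ s t : ℕ → ℝ, Filter.Tendsto s Filter.atTop (nhds 0) ∧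
      Filter.Tendsto t Filter.atTop (nhds 0) ∧ (∀ n, 0 < s n ∧ s n < r) ∧
      (∀ n, 0 < t n ∧ t n < r) ∧ (∀ n, γ (- s n) ∈ M) ∧ ∀ n, γ (t n) ∈ M := by
  obtain ⟨ε₀, h0, -, h⟩ := hacc
  have key : ∀ n : ℕ, ∃ s t : ℝ, 0 < s ∧ s < r ∧ s < 1 / ((n : ℝ) + 1) ∧ 0 < t ∧ t < r ∧
      t < 1 / ((n : ℝ) + 1) ∧ γ (-s) ∈ M ∧ γ t ∈ M := by
    intro n
    set ε := min ε₀ (min r (1 / ((n : ℝ) + 1))) with hε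
    have hn : 0 < 1 / ((n : ℝ) + 1) := by positivity
    have hε0 : 0 < ε := lt_min h0 (lt_min hr hn)
    have e1 : ε ≤ r := (min_le_right _ _).trans (min_le_left _ _)
    have e2 : ε ≤ 1 / ((n : ℝ) + 1) := (min_le_right _ _).trans (min_le_right _ _)
    obtain ⟨⟨a, ha, haM⟩, ⟨b, hb, hbM⟩⟩ := h ε hε0 (min_le_left _ _)
    have hp : 0 < ε ^ (1 + β) := Real.rpow_pos_of_pos hε0 _
    obtain ⟨ha1, ha2⟩ := ha
    obtain ⟨hb1, hb2⟩ := hb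
    refine ⟨-a, b, by linarith, by linarith, by linarith, by linarith, by linarith, by linarith,
      by rwa [neg_neg], hbM⟩
  choose s t h1 h2 h3 h4 h5 h6 h7 h8 using key
  refine ⟨s, t, ?_, ?_, fun n => ⟨h1 n, h2 n⟩, fun n => ⟨h4 n, h5 n⟩, h7, h8⟩
  · exact squeeze_zero (fun n => (h1 n).le) (fun n => (h3 n).le)
      tendsto_one_div_add_atTop_nhds_zero_nat
  · exact squeeze_zero (fun n => (h4 n).le) (fun n => (h6 n).le)
      tendsto_one_div_add_atTop_nhds_zero_nat

lemma aux_false (τ β δ : ℝ) (hτ : 6 < τ ^ 2)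
    (ρ : Measure E3) (hmin : IsMinimizer τ ρ) (hδ : 0 < δ)
    (γ : ℝ → E3) (hsm : ∀ n : ℕ, ContDiffOn ℝ n γ (Set.Ioo (-δ) δ))
    (h0 : γ 0 = mkE3 1 0 0) (h1 : deriv γ 0 = mkE3 0 1 0)
    (hacc : UniformTwoSidedAcc (msupport ρ) β δ γ) : False := by
  have hprob := hmin.1
  have hS := hmin.2.2.1
  -- `p` lies in the support
  have hpM : mkE3 1 0 0 ∈ msupport ρ := by
    obtain ⟨s, t, -, ht, -, -, -, htM⟩ := aux_seq _ β δ γ hacc 1 one_pos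
    have hc : ContinuousAt γ 0 :=
      (hsm 0).continuousOn.continuousAt (Ioo_mem_nhds (by linarith) hδ)
    intro U hU hpU
    have h2 : Filter.Tendsto (fun n => γ (t n)) Filter.atTop (nhds (γ 0)) := hc.tendsto.comp ht
    rw [h0] at h2
    obtain ⟨n, hn⟩ := (h2.eventually (hU.mem_nhds hpU)).exists
    exact htM n U hU hn
  obtain ⟨K, r, hK, hr, hr1, hXγ, hnear⟩ := aux_near τ δ ρ hmin hδ γ hsm h0 h1 hpM
  obtain ⟨s, t, hs, ht, hs0, ht0, hsM, htM⟩ := aux_seq _ β δ γ hacc r hr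
  set p : E3 := mkE3 1 0 0 with hp
  have hpS := aux_supp_sphere ρ hS hpM
  have hEn := fun n => hnear (s n) (t n) (hs0 n).1 (hs0 n).2 (ht0 n).1 (ht0 n).2 (hsM n) (htM n)
  have hsS := fun n => aux_supp_sphere ρ hS (hsM n)
  have htS := fun n => aux_supp_sphere ρ hS (htM n)
  have hs1 : ∀ n, 0 < s n ∧ s n ≤ 1 := fun n => ⟨(hs0 n).1, (hs0 n).2.le.trans hr1⟩
  have ht1 : ∀ n, 0 < t n ∧ t n ≤ 1 := fun n => ⟨(ht0 n).1, (ht0 n).2.le.trans hr1⟩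
  have hsX : ∀ n, ‖Xc (- s n) - γ (- s n)‖ ≤ K * (s n) ^ 2 := fun n => by
    have := hXγ (- s n) (by rw [abs_neg, abs_of_pos (hs0 n).1]; exact (hs0 n).2)
    rwa [neg_sq] at this
  have htX : ∀ n, ‖Xc (t n) - γ (t n)‖ ≤ K * (t n) ^ 2 := fun n =>
    hXγ (t n) (by rw [abs_of_pos (ht0 n).1]; exact (ht0 n).2)
  set σ : ℕ → ℝ := fun n => if s n ≤ t n then t n else - s n with hσ
  have hσ0 : ∀ n, σ n ≠ 0 ∧ |σ n| ≤ 1 := by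
    intro n
    simp only [hσ]
    split_ifs
    · exact ⟨(ht1 n).1.ne', by rw [abs_of_pos (ht1 n).1]; exact (ht1 n).2⟩
    · exact ⟨neg_ne_zero.2 (hs1 n).1.ne', by rw [abs_neg, abs_of_pos (hs1 n).1]; exact (hs1 n).2⟩
  have hσt : Filter.Tendsto σ Filter.atTop (nhds 0) := by
    refine squeeze_zero_norm (a := fun n => s n + t n) (fun n => ?_) (by simpa using hs.add ht)
    have a := (hs1 n).1
    have b := (ht1 n).1
    simp only [hσ, Real.norm_eq_abs]
    split_ifs
    · rw [abs_of_pos b]; linarith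
    · rw [abs_neg, abs_of_pos a]; linarith
  have hXS : ∀ n, Xc (σ n) ∈ Sphere2 := fun n => aux_X_sph _ (hσ0 n).2
  -- quadratic bound of the excess
  set K2 : ℝ := 2 * K + 2 * (1 + τ ^ 2) * K with hK2
  have hEb : ∀ n, ∀ q ∈ msupport ρ, Efun τ p (Xc (σ n)) q ≤ K2 * (σ n) ^ 2 := by
    intro n q hq
    have hqS := aux_supp_sphere ρ hS hq
    have a := hEn n q hq
    have sp := (hs1 n).1
    have tp := (ht1 n).1
    have n1 := mul_nonneg (one_div_pos.2 tp).le (aux_E_nonneg τ p (γ (t n)) q)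
    have n2 := mul_nonneg (one_div_pos.2 sp).le (aux_E_nonneg τ p (γ (-s n)) q)
    have hτp : 0 ≤ 2 * (1 + τ ^ 2) := by positivity
    simp only [hσ]
    split_ifs with hst
    · have l1 : Efun τ p (γ (t n)) q ≤ t n * (K * (s n + t n)) := by
        rw [← div_le_iff₀' tp, div_eq_inv_mul, ← one_div]; linarith
      have l2 := aux_E_lip τ p (Xc (t n)) (γ (t n)) q
        (aux_X_sph _ (by rw [abs_of_pos tp]; exact (ht1 n).2)) (htS n) hqS
      have l3 := mul_le_mul_of_nonneg_left (htX n) hτp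
      have l4 : t n * (K * (s n + t n)) ≤ t n * (K * (t n + t n)) := by gcongr
      rw [hK2]; linarith
    · push Not at hst
      have l1 : Efun τ p (γ (- s n)) q ≤ s n * (K * (s n + t n)) := by
        rw [← div_le_iff₀' sp, div_eq_inv_mul, ← one_div]; linarith
      have l2 := aux_E_lip τ p (Xc (- s n)) (γ (- s n)) q
        (aux_X_sph _ (by rw [abs_neg, abs_of_pos sp]; exact (hs1 n).2)) (hsS n) hqS
      have l3 := mul_le_mul_of_nonneg_left (hsX n) hτp
      have l4 : s n * (K * (s n + t n)) ≤ s n * (K * (s n + s n)) := by gcongr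
      rw [hK2, neg_sq]; linarith
  have hEz : ∀ q ∈ msupport ρ, ∀ᶠ n in Filter.atTop, Efun τ p (Xc (σ n)) q = 0 := by
    intro q hq
    refine aux_evzero τ hτ q (fun hD => ?_) σ hσt (fun n => (hσ0 n).2)
    exact aux_bdry τ hτ γ q (aux_supp_sphere ρ hS hq) hD K s t hs ht hs1 ht1 hsS htS hK hsX htX
      (fun n => hEn n q hq)
  -- the restricted measure
  set I : Set E3 := {q | 0 < Dfun τ p q} with hI
  have hIo : IsOpen I := isOpen_lt continuous_const (aux_Dcont_right τ p)
  have hpI : p ∈ I := by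
    show 0 < Dfun τ p p
    rw [aux_Dself τ p hpS]; exact one_pos
  set ν := ρ.restrict I with hν
  have hi : ∀ f : E3 → ℝ, Continuous f → Integrable f ν := fun f hf =>
    (aux_int ρ hS f hf).restrict
  have haeν : ∀ᵐ q ∂ν, q ∈ Sphere2 ∧ 0 < Dfun τ p q := by
    have h3 : ∀ᵐ q ∂ν, q ∈ I := ae_restrict_mem hIo.measurableSet
    have h4 : ∀ᵐ q ∂ν, q ∈ Sphere2 := ae_restrict_of_ae (aux_ae ρ hS)
    filter_upwards [h3, h4] with q a b using ⟨b, a⟩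
  have hEint : ∀ x, Integrable (Efun τ p x) ρ := fun x =>
    (aux_int ρ hS _ (aux_Lcont_right τ x)).sub
      ((aux_int ρ hS _ (aux_Dcont_right τ x)).indicator hIo.measurableSet)
  have hsplit : ∀ x, ∫ q, Lfun τ x q ∂ρ = ∫ q, Dfun τ x q ∂ν + ∫ q, Efun τ p x q ∂ρ := by
    intro x
    have : ∫ q, Efun τ p x q ∂ρ = ∫ q, Lfun τ x q ∂ρ - ∫ q, I.indicator (Dfun τ x) q ∂ρ :=
      integral_sub (aux_int ρ hS _ (aux_Lcont_right τ x))
        ((aux_int ρ hS _ (aux_Dcont_right τ x)).indicator hIo.measurableSet)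
    rw [this, integral_indicator hIo.measurableSet]; ring
  have hEp : ∀ q, Efun τ p p q = 0 := by
    intro q
    by_cases h : 0 < Dfun τ p q
    · rw [aux_E_pos _ _ _ _ h, sub_eq_zero]; exact max_eq_right h.le
    · rw [aux_E_neg _ _ _ _ h]; exact max_eq_left (not_lt.1 h)
  set S := causalAction τ ρ with hSdef
  set f : ℝ → ℝ := fun u => ∫ q, Dfun τ (Xc u) q ∂ν with hf
  have hf0 : f 0 = S := by
    have a := hsplit p
    simp only [hEp, integral_zero, add_zero] at a
    have : f 0 = ∫ q, Dfun τ p q ∂ν := by simp only [hf, aux_Xc0, hp]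
    rw [this, ← a]
    exact le_antisymm (aux_EL2 τ ρ hmin p hpM) (aux_EL1 τ ρ hmin p hpS)
  have hFle : ∀ x ∈ msupport ρ, ∫ q, Dfun τ x q ∂ν ≤ S := by
    intro x hx
    have a := hsplit x
    have b := aux_EL2 τ ρ hmin x hx
    have c : 0 ≤ ∫ q, Efun τ p x q ∂ρ := integral_nonneg (aux_E_nonneg τ p x)
    linarith
  have hmass : ν.real univ ≤ 1 := by
    rw [hν, measureReal_restrict_apply_univ]; exact measureReal_le_one
  have hFlip : ∀ x ∈ Sphere2, ∀ y ∈ Sphere2, ∫ q, Dfun τ x q ∂ν ≤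
      ∫ q, Dfun τ y q ∂ν + (1 + τ ^ 2) * ‖x - y‖ := by
    intro x hx y hy
    have a : ‖∫ q, (Dfun τ x q - Dfun τ y q) ∂ν‖ ≤ ((1 + τ ^ 2) * ‖x - y‖) * ν.real univ :=
      norm_integral_le_of_norm_le_const (by
        filter_upwards [haeν] with q hq using aux_Dlip τ x y q hx hy hq.1)
    rw [integral_sub (hi _ (aux_Dcont_right τ x)) (hi _ (aux_Dcont_right τ y))] at a
    have b : ((1 + τ ^ 2) * ‖x - y‖) * ν.real univ ≤ ((1 + τ ^ 2) * ‖x - y‖) * 1 := by gcongr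
    have c := (abs_le.1 a).2
    linarith
  -- moments
  have hm : 0 < ∫ _, (1 : ℝ) ∂ν := by
    simp only [integral_const, smul_eq_mul, mul_one]
    rw [hν, measureReal_restrict_apply_univ]
    exact ENNReal.toReal_pos (hpM I hIo hpI).ne' (measure_ne_top _ _)
  have hQ : ∫ q, q 1 ^ 2 ∂ν ≤ (∫ _, (1 : ℝ) ∂ν) - ∫ q, q 0 ^ 2 ∂ν := by
    rw [← integral_sub (hi _ continuous_const) (hi _ (by fun_prop))]
    refine integral_mono_ae (hi _ (by fun_prop)) (hi _ (by fun_prop)) ?_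
    filter_upwards [haeν] with q hq
    have := aux_sph2 q hq.1
    nlinarith [sq_nonneg (q 2)]
  have hQ0 : (∫ _, (1 : ℝ) ∂ν) * (1 - 2 / τ ^ 2) ^ 2 ≤ ∫ q, q 0 ^ 2 ∂ν := by
    rw [← integral_mul_const]
    refine integral_mono_ae (hi _ (by fun_prop)) (hi _ (by fun_prop)) ?_
    filter_upwards [haeν] with q hq
    have c := abs_le.1 (aux_coord q hq.1 0)
    have d := hq.2
    rw [hp, aux_Dp] at d
    have e1 : 0 ≤ (1 / 4) * (1 + q 0) := by linarith [c.1]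
    have e2 : 0 < 2 - τ ^ 2 * (1 - q 0) := pos_of_mul_pos_right d e1
    have hT : 0 < τ ^ 2 := by linarith
    have e3 : 1 - 2 / τ ^ 2 ≤ q 0 := by
      have : 1 - q 0 ≤ 2 / τ ^ 2 := by rw [le_div_iff₀ hT]; linarith
      linarith
    have e4 : 0 ≤ 1 - 2 / τ ^ 2 := by
      rw [sub_nonneg, div_le_one hT]; linarith
    rw [one_mul]
    exact pow_le_pow_left₀ e4 e3 2
  -- dominated convergence
  have he : Filter.Tendsto (fun n => ∫ q, Efun τ p (Xc (σ n)) q / (σ n) ^ 2 ∂ρ) Filter.atTop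
      (nhds 0) := by
    have := tendsto_integral_of_dominated_convergence (μ := ρ)
      (F := fun n q => Efun τ p (Xc (σ n)) q / (σ n) ^ 2) (f := fun _ => (0 : ℝ)) (fun _ => K2)
      (fun n => ((hEint _).div_const _).aestronglyMeasurable) (integrable_const _)
      (fun n => by
        filter_upwards [aux_ae_supp ρ] with q hq
        have h4 : 0 < σ n ^ 2 := by have := (hσ0 n).1; positivity
        rw [Real.norm_eq_abs, abs_of_nonneg (div_nonneg (aux_E_nonneg _ _ _ _) h4.le),
          div_le_iff₀ h4]
        exact hEb n q hq)
      (by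
        filter_upwards [aux_ae_supp ρ] with q hq
        refine tendsto_const_nhds.congr' ?_
        filter_upwards [hEz q hq] with n hn
        rw [hn, zero_div])
    simpa using this
  refine aux_final τ _ _ _ _ _ _ S ((1 + τ ^ 2) * K) hτ hm (aux_S_nonneg τ ρ) hQ hQ0 f
    (fun u => aux_F τ ν hi u) hf0 s t σ _ hs ht hσt he hs1 ht1 hσ0 (by positivity) ?_ ?_ ?_
  · intro n
    have a := hFlip (Xc (t n)) (aux_X_sph _ (by rw [abs_of_pos (ht1 n).1]; exact (ht1 n).2))
      _ (htS n)
    have b := hFle _ (htM n)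
    have c := mul_le_mul_of_nonneg_left (htX n) (show 0 ≤ 1 + τ ^ 2 by positivity)
    simp only [hf]; linarith
  · intro n
    have a := hFlip (Xc (- s n)) (aux_X_sph _ (by
      rw [abs_neg, abs_of_pos (hs1 n).1]; exact (hs1 n).2)) _ (hsS n)
    have b := hFle _ (hsM n)
    have c := mul_le_mul_of_nonneg_left (hsX n) (show 0 ≤ 1 + τ ^ 2 by positivity)
    simp only [hf]; linarith
  · intro n
    have a := aux_EL1 τ ρ hmin _ (hXS n)
    rw [hsplit] at a
    have h4 : σ n ^ 2 ≠ 0 := pow_ne_zero _ (hσ0 n).1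
    rw [integral_div, div_mul_cancel₀ _ h4]
    exact a



/-- Proposition 7.5: if `q₁` is an accumulation point of `M`, then it
is an accumulation point of points of `M` lying on a real analytic curve which
osculates `K(p)` at `q₁`. -/
theorem stmt_15 (τ β δ : ℝ) (hτ : Real.sqrt 6 < τ) (hβ0 : 0 < β) (hβ : β < 1 / 6)
    (ρ : Measure E3) (hmin : IsMinimizer τ ρ) (hδ : 0 < δ)
    (γ : ℝ → E3) (hsm : ∀ n : ℕ, ContDiffOn ℝ n γ (Set.Ioo (-δ) δ))
    (hmap : ∀ t ∈ Set.Ioo (-δ) δ, γ t ∈ Sphere2)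
    (harc : ∀ t ∈ Set.Ioo (-δ) δ, ‖deriv γ t‖ = 1)
    (h0 : γ 0 = mkE3 1 0 0) (h1 : deriv γ 0 = mkE3 0 1 0)
    (hacc : UniformTwoSidedAcc (msupport ρ) β δ γ)
    (hq1 : AccumulationPt (q1pt τ) (msupport ρ)) :
    ∃ δ' : ℝ, 0 < δ' ∧ ∃ c : ℝ → E3,
      AnalyticOnNhd ℝ c (Set.Ioo (-δ') δ') ∧
      (∀ t ∈ Set.Ioo (-δ') δ', c t ∈ Sphere2) ∧
      (∀ t ∈ Set.Ioo (-δ') δ', ‖deriv c t‖ = 1) ∧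
      c 0 = q1pt τ ∧
      deriv (fun t => ⟪mkE3 1 0 0, c t⟫) 0 = 0 ∧
      deriv (deriv fun t => ⟪mkE3 1 0 0, c t⟫) 0 = 0 ∧
      AccumulationPt (q1pt τ) (msupport ρ ∩ c '' Set.Ioo (-δ') δ') := by
  exfalso
  refine aux_false τ β δ ?_ ρ hmin hδ γ hsm h0 h1 hacc
  have h6 := Real.sq_sqrt (show (0 : ℝ) ≤ 6 by norm_num)
  have h7 := Real.sqrt_nonneg 6
  nlinarith
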